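/- Every 1-generic Turing degree satisfies the join property: if a is 1-generic then for every non-zero degree b < a there exists c < a such that b ∨ c = a. -/

import Mathlib

/-
Common framework: oracle (relative) partial computability via codes,
Turing reducibility, the jump, Cantor-space measure, Martin-Löf randomness
and genericity relative to an oracle, Turing functionals.
-/

open scoped ENNReal

namespace TypicalDegree

/-- Codes for partial functions recursive in an oracle (Kleene-style),
    following `Nat.Partrec.Code` with an extra `oracle` constructor. -/
inductive OracleCode : Type
  | zero : OracleCode
  | succ : OracleCode
  | left : OracleCode
  | right : OracleCode
  | oracle : OracleCode
  | pair : OracleCode → OracleCode → OracleCode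
  | comp : OracleCode → OracleCode → OracleCode
  | prec : OracleCode → OracleCode → OracleCode
  | rfind' : OracleCode → OracleCode

/-- Evaluation of an oracle code relative to an oracle `g : ℕ →. ℕ`. -/
def OracleCode.eval (g : ℕ →. ℕ) : OracleCode → ℕ →. ℕ
  | .zero => pure 0
  | .succ => Nat.succ
  | .left => ↑fun n : ℕ => n.unpair.1
  | .right => ↑fun n : ℕ => n.unpair.2
  | .oracle => g
  | .pair cf cg => fun n => Nat.pair <$> OracleCode.eval g cf n <*> OracleCode.eval g cg n
  | .comp cf cg => fun n => OracleCode.eval g cg n >>= OracleCode.eval g cf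
  | .prec cf cg =>
    Nat.unpaired fun a n =>
      n.rec (OracleCode.eval g cf a) fun y IH => do
        let i ← IH
        OracleCode.eval g cg (Nat.pair a (Nat.pair y i))
  | .rfind' cf =>
    Nat.unpaired fun a m =>
      (Nat.rfind fun n => (fun m => m = 0) <$> OracleCode.eval g cf (Nat.pair a (n + m))).map
        (· + m)

/-- An effective injective numbering of oracle codes. -/
def OracleCode.encodeCode : OracleCode → ℕ
  | .zero => 0
  | .succ => 1
  | .left => 2
  | .right => 3
  | .oracle => 4
  | .pair cf cg => 4 * Nat.pair cf.encodeCode cg.encodeCode + 5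
  | .comp cf cg => 4 * Nat.pair cf.encodeCode cg.encodeCode + 6
  | .prec cf cg => 4 * Nat.pair cf.encodeCode cg.encodeCode + 7
  | .rfind' cf => 4 * Nat.pair cf.encodeCode cf.encodeCode + 8

/-- The characteristic (total) oracle of an element of Cantor space. -/
def chi (X : ℕ → Bool) : ℕ →. ℕ := fun n => Part.some (cond (X n) 1 0)

/-- `f` is partial recursive relative to the oracle `g`. -/
def RedIn (f g : ℕ →. ℕ) : Prop := ∃ c : OracleCode, c.eval g = f

/-- A total function `ℕ → ℕ` viewed as a partial function. -/
def natFun (f : ℕ → ℕ) : ℕ →. ℕ := fun n => Part.some (f n)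

/-- Turing reducibility between elements of Cantor space. -/
def TRed (X Y : ℕ → Bool) : Prop := RedIn (chi X) (chi Y)

/-- Turing equivalence. -/
def TEquiv (X Y : ℕ → Bool) : Prop := TRed X Y ∧ TRed Y X

/-- `X` is computable. -/
def ComputableSeq (X : ℕ → Bool) : Prop := TRed X fun _ => false

/-- `f : ℕ → ℕ` is computable. -/
def ComputableFun (f : ℕ → ℕ) : Prop := RedIn (natFun f) (chi fun _ => false)

/-- The Turing jump of `X`: the halting problem relative to `X`,
    under the numbering `encodeCode`. -/
noncomputable def jump (X : ℕ → Bool) : ℕ → Bool := fun n =>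
  @decide (∃ c : OracleCode, c.encodeCode = n ∧ (c.eval (chi X) n).Dom) (Classical.dec _)

/-- `∅'`, the halting problem. -/
noncomputable def zeroJump : ℕ → Bool := jump fun _ => false

/-- `X` extends the finite binary string `σ` (i.e. `σ ⊂ X`). -/
def extendsStr (X : ℕ → Bool) (σ : List Bool) : Prop :=
  ∀ i : Fin σ.length, X i.1 = σ.get i

/-- `⟦V⟧`: the open set of infinite sequences extending some string in `V`. -/
def openOf (V : Set (List Bool)) : Set (ℕ → Bool) := {X | ∃ σ ∈ V, extendsStr X σ}

/-- The (fair-coin) measure of the open set `⟦V⟧` determined by a set of strings `V`: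
    the supremum over `n` of the proportion of length-`n` strings with a prefix in `V`. -/
noncomputable def stringMeasure (V : Set (List Bool)) : ℝ≥0∞ :=
  ⨆ n : ℕ, (Nat.card {f : Fin n → Bool // ∃ σ ∈ V, σ <+: List.ofFn f} : ℝ≥0∞) / 2 ^ n

/-- The fair-coin (Lebesgue) measure on Cantor space, as the outer measure obtained from
    open coverings by sets of strings; it agrees with Lebesgue measure on measurable sets. -/
noncomputable def cantorMeasure (S : Set (ℕ → Bool)) : ℝ≥0∞ :=
  ⨅ (V : Set (List Bool)) (_ : S ⊆ openOf V), stringMeasure V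

/-- `W` is computably enumerable relative to `X`. -/
def CEIn (X : ℕ → Bool) (W : Set (List Bool)) : Prop :=
  ∃ c : OracleCode, ∀ σ : List Bool, σ ∈ W ↔ (c.eval (chi X) (Encodable.encode σ)).Dom

/-- `W` is computably enumerable. -/
def CE (W : Set (List Bool)) : Prop := CEIn (fun _ => false) W

/-- The c.e. set of strings with index `d`. -/
def ceSetOf (d : OracleCode) : Set (List Bool) :=
  {σ | (d.eval (chi fun _ => false) (Encodable.encode σ)).Dom}

/-- The sequence `V` of sets of strings is uniformly c.e. relative to `X`. -/
def UniformCEIn (X : ℕ → Bool) (V : ℕ → Set (List Bool)) : Prop :=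
  ∃ c : OracleCode, ∀ (i : ℕ) (σ : List Bool),
    σ ∈ V i ↔ (c.eval (chi X) (Nat.pair i (Encodable.encode σ))).Dom

/-- A Martin-Löf test relative to `X`. -/
def MLTest (X : ℕ → Bool) (V : ℕ → Set (List Bool)) : Prop :=
  UniformCEIn X V ∧ ∀ i : ℕ, stringMeasure (V i) < (2 : ℝ≥0∞)⁻¹ ^ i

/-- `Y` is Martin-Löf random relative to `X`. -/
def MLRandomIn (X Y : ℕ → Bool) : Prop :=
  ∀ V : ℕ → Set (List Bool), MLTest X V → ∃ i, Y ∉ openOf (V i)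

/-- `Y` is 1-random. -/
def OneRandom (Y : ℕ → Bool) : Prop := MLRandomIn (fun _ => false) Y

/-- `Y` is 2-random: Martin-Löf random relative to `∅'`. -/
def TwoRandom (Y : ℕ → Bool) : Prop := MLRandomIn zeroJump Y

/-- `Y` is weakly 2-random: it avoids every null `Π⁰₂` class
    (every null intersection of a uniformly c.e. sequence of open sets). -/
def Weak2Random (Y : ℕ → Bool) : Prop :=
  ∀ V : ℕ → Set (List Bool), UniformCEIn (fun _ => false) V →
    cantorMeasure (⋂ i, openOf (V i)) = 0 → Y ∉ ⋂ i, openOf (V i)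

/-- `Y` is 1-generic relative to `X`. -/
def OneGenericIn (X Y : ℕ → Bool) : Prop :=
  ∀ W : Set (List Bool), CEIn X W →
    ∃ σ : List Bool, extendsStr Y σ ∧ (σ ∈ W ∨ ∀ τ : List Bool, σ <+: τ → τ ∉ W)

/-- `Y` is 1-generic. -/
def OneGeneric (Y : ℕ → Bool) : Prop := OneGenericIn (fun _ => false) Y

/-- `Y` is 2-generic: 1-generic relative to `∅'`. -/
def TwoGeneric (Y : ℕ → Bool) : Prop := OneGenericIn zeroJump Y

/-- The Turing functional coded by `c` is total on oracle `X` with value `Y ∈ 2^ω`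
    (i.e. `Ψ^X = Y`). -/
def FTotal (c : OracleCode) (X : ℕ → Bool) (Y : ℕ → Bool) : Prop :=
  c.eval (chi X) = chi Y

/-- `Ψ^X ⊇ σ`: the output of the functional `c` on oracle `X` extends the string `σ`. -/
def FExtends (c : OracleCode) (X : ℕ → Bool) (σ : List Bool) : Prop :=
  ∀ i : Fin σ.length, c.eval (chi X) i.1 = Part.some (cond (σ.get i) 1 0)

/-- `π(Ψ,σ) = μ({X : Ψ^X ⊇ σ})`. -/
noncomputable def piMeasure (c : OracleCode) (σ : List Bool) : ℝ≥0∞ :=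
  cantorMeasure {X | FExtends c X σ}

/-- A Turing functional is special if every infinite binary sequence
    in its range is incomputable. -/
def Special (c : OracleCode) : Prop :=
  ∀ X Y : ℕ → Bool, FTotal c X Y → ¬ ComputableSeq Y

/-- The code `c` computes the total function `T` on strings (no oracle). -/
def ComputesFun (c : OracleCode) (T : List Bool → Bool) : Prop :=
  ∀ σ : List Bool, c.eval (chi fun _ => false) (Encodable.encode σ) = Part.some (cond (T σ) 1 0)

/-- `T` is (the characteristic function of) a tree: closed under prefixes. -/
def IsTree (T : List Bool → Bool) : Prop :=
  ∀ σ τ : List Bool, σ <+: τ → T τ = true → T σ = true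

/-- The set of infinite paths through the tree `T`; `Π⁰₁` classes are the
    sets of paths through computable trees. -/
def pathsOf (T : List Bool → Bool) : Set (ℕ → Bool) :=
  {X | ∀ n : ℕ, T (List.ofFn fun i : Fin n => X i.1) = true}

/-- The computable join `X ⊕ Y`. -/
def join (X Y : ℕ → Bool) : ℕ → Bool := fun n =>
  if n % 2 = 0 then X (n / 2) else Y (n / 2)

/-- A finite string used as a (partial) oracle. -/
def strOracle (τ : List Bool) : ℕ →. ℕ := fun n =>
  if h : n < τ.length then Part.some (cond (τ.get ⟨n, h⟩) 1 0) else Part.none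

/-- `Ψ^{τ₀}` and `Ψ^{τ₁}` are incompatible: they give different outputs somewhere. -/
def SplitPair (c : OracleCode) (τ₀ τ₁ : List Bool) : Prop :=
  ∃ (n v₀ v₁ : ℕ), v₀ ∈ c.eval (strOracle τ₀) n ∧ v₁ ∈ c.eval (strOracle τ₁) n ∧ v₀ ≠ v₁

/-- `(U,V)` is a `Ψ`-splitting above `τ`. -/
def SplittingAbove (c : OracleCode) (τ : List Bool) (U V : Finset (List Bool)) : Prop :=
  (∃ ℓ : ℕ, ∀ σ ∈ U ∪ V, σ.length = ℓ ∧ τ <+: σ) ∧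
    ∀ σ₀ ∈ U, ∀ σ₁ ∈ V, SplitPair c σ₀ σ₁

/-- The output sequence `Ψ^X` of the functional `c` on oracle `X`
    (defaults to `false` when not total). -/
noncomputable def outSeq (c : OracleCode) (X : ℕ → Bool) : ℕ → Bool := fun n =>
  @dite _ (∃ Y : ℕ → Bool, FTotal c X Y) (Classical.dec _) (fun h => h.choose n) fun _ => false

/-- `Ψ^X ↾ n`, as a finite string. -/
noncomputable def outStr (c : OracleCode) (X : ℕ → Bool) (n : ℕ) : List Bool :=
  List.ofFn fun i : Fin n => outSeq c X i.1

/-- The degree of `M` is a minimal Turing degree. -/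
def MinimalDeg (M : ℕ → Bool) : Prop :=
  ¬ ComputableSeq M ∧ ∀ Z : ℕ → Bool, TRed Z M → ComputableSeq Z ∨ TRed M Z


/-- The initial segment of `X` of length `m`. -/
def res (X : ℕ → Bool) (m : ℕ) : List Bool := (List.range m).map X

@[simp] theorem res_length (X : ℕ → Bool) (m : ℕ) : (res X m).length = m := by simp [res]

theorem res_getElem? (X : ℕ → Bool) (m i : ℕ) :
    (res X m)[i]? = if i < m then some (X i) else none := by
  by_cases h : i < m <;> simp [res, h]

theorem res_succ (X : ℕ → Bool) (m : ℕ) : res X (m + 1) = res X m ++ [X m] := by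
  simp [res, List.range_succ]

theorem extendsStr_iff (X : ℕ → Bool) (σ : List Bool) : extendsStr X σ ↔ res X σ.length = σ := by
  unfold extendsStr
  constructor
  · intro h
    apply List.ext_getElem?
    intro i
    rw [res_getElem?]
    by_cases hi : i < σ.length
    · have := h ⟨i, hi⟩
      simp [hi] at this ⊢
      exact this
    · simp [hi]
  · intro h i
    have h2 : (res X σ.length)[i.1]? = σ[i.1]? := by rw [h]
    rw [res_getElem?] at h2
    simpa using h2

theorem extendsStr_res (X : ℕ → Bool) (m : ℕ) : extendsStr X (res X m) := by
  rw [extendsStr_iff]; simp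

theorem res_prefix (X : ℕ → Bool) {m n : ℕ} (h : m ≤ n) : res X m <+: res X n := by
  obtain ⟨k, rfl⟩ := Nat.exists_eq_add_of_le h
  exact ⟨((List.range k).map (m + ·)).map X, by simp [res, List.range_add]⟩

theorem extendsStr_iff_prefix (X : ℕ → Bool) (σ : List Bool) :
    extendsStr X σ ↔ ∃ m, σ <+: res X m := by
  constructor
  · intro h; exact ⟨σ.length, by rw [(extendsStr_iff X σ).1 h]⟩
  · rintro ⟨m, h⟩
    rw [extendsStr_iff]
    have hl := h.length_le
    simp at hl
    have h2 := res_prefix X hl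
    exact (List.prefix_of_prefix_length_le h2 h (by simp)).eq_of_length (by simp)

theorem extendsStr.mono {X : ℕ → Bool} {σ τ : List Bool} (h : extendsStr X τ) (hs : σ <+: τ) :
    extendsStr X σ := by
  rw [extendsStr_iff_prefix] at *
  obtain ⟨m, hm⟩ := h
  exact ⟨m, hs.trans hm⟩

theorem extendsStr.prefix {X : ℕ → Bool} {σ τ : List Bool} (h : extendsStr X τ)
    (h' : extendsStr X σ) (hl : σ.length ≤ τ.length) : σ <+: τ := by
  rw [← (extendsStr_iff X σ).1 h', ← (extendsStr_iff X τ).1 h]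
  exact res_prefix X hl

theorem extendsStr.getElem? {X : ℕ → Bool} {σ : List Bool} (h : extendsStr X σ) {i : ℕ} {b : Bool}
    (hb : σ[i]? = some b) : X i = b := by
  rw [← (extendsStr_iff X σ).1 h, res_getElem?] at hb
  grind

/-! ### Codes without oracle -/

/-- Translation of ordinary codes to oracle codes. -/
def ofCode : Nat.Partrec.Code → OracleCode
  | .zero => .zero
  | .succ => .succ
  | .left => .left
  | .right => .right
  | .pair a b => .pair (ofCode a) (ofCode b)
  | .comp a b => .comp (ofCode a) (ofCode b)
  | .prec a b => .prec (ofCode a) (ofCode b)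
  | .rfind' a => .rfind' (ofCode a)

theorem ofCode_eval (g : ℕ →. ℕ) (c : Nat.Partrec.Code) : (ofCode c).eval g = c.eval := by
  induction c with
  | zero => rfl
  | succ => rfl
  | left => rfl
  | right => rfl
  | pair a b iha ihb =>
    simp only [ofCode, OracleCode.eval, Nat.Partrec.Code.eval, iha, ihb]; rfl
  | comp a b iha ihb =>
    simp only [ofCode, OracleCode.eval, Nat.Partrec.Code.eval, iha, ihb]; rfl
  | prec a b iha ihb =>
    simp only [ofCode, OracleCode.eval, Nat.Partrec.Code.eval, iha, ihb]; rfl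
  | rfind' a iha =>
    simp only [ofCode, OracleCode.eval, Nat.Partrec.Code.eval, iha]; rfl

theorem exists_oracleCode {f : ℕ →. ℕ} (hf : Nat.Partrec f) (g : ℕ →. ℕ) :
    ∃ c : OracleCode, c.eval g = f := by
  obtain ⟨c, rfl⟩ := Nat.Partrec.Code.exists_code.1 hf
  exact ⟨ofCode c, ofCode_eval g c⟩

/-! ### The use principle -/

theorem mem_eval_pair {g : ℕ →. ℕ} {a b : OracleCode} {n v : ℕ} :
    v ∈ (OracleCode.pair a b).eval g n ↔
      ∃ x ∈ a.eval g n, ∃ y ∈ b.eval g n, v = Nat.pair x y := by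
  simp only [OracleCode.eval, Seq.seq, Part.mem_bind_iff, Part.map_eq_map, Part.mem_map_iff]
  constructor
  · rintro ⟨f, ⟨x, hx, rfl⟩, y, hy, rfl⟩; exact ⟨x, hx, y, hy, rfl⟩
  · rintro ⟨x, hx, y, hy, rfl⟩; exact ⟨_, ⟨x, hx, rfl⟩, y, hy, rfl⟩

theorem mem_eval_comp {g : ℕ →. ℕ} {a b : OracleCode} {n v : ℕ} :
    v ∈ (OracleCode.comp a b).eval g n ↔ ∃ x ∈ b.eval g n, v ∈ a.eval g x :=
  Part.mem_bind_iff

theorem mem_eval_prec_zero {g : ℕ →. ℕ} {a b : OracleCode} {p v : ℕ} :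
    v ∈ (OracleCode.prec a b).eval g (Nat.pair p 0) ↔ v ∈ a.eval g p := by
  simp only [OracleCode.eval, Nat.unpaired, Nat.unpair_pair]
  exact Iff.rfl

theorem mem_eval_prec_succ {g : ℕ →. ℕ} {a b : OracleCode} {p k v : ℕ} :
    v ∈ (OracleCode.prec a b).eval g (Nat.pair p (k + 1)) ↔
      ∃ x ∈ (OracleCode.prec a b).eval g (Nat.pair p k),
        v ∈ b.eval g (Nat.pair p (Nat.pair k x)) := by
  simp only [OracleCode.eval, Nat.unpaired, Nat.unpair_pair]
  exact Part.mem_bind_iff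

theorem mem_eval_rfind {g : ℕ →. ℕ} {a : OracleCode} {p k v : ℕ} :
    v ∈ (OracleCode.rfind' a).eval g (Nat.pair p k) ↔
      ∃ x, v = x + k ∧ 0 ∈ a.eval g (Nat.pair p (x + k)) ∧
        ∀ j < x, ∃ z, z ≠ 0 ∧ z ∈ a.eval g (Nat.pair p (j + k)) := by
  simp only [OracleCode.eval, Nat.unpaired, Nat.unpair_pair, Part.mem_map_iff]
  constructor
  · rintro ⟨x, hx, rfl⟩
    obtain ⟨h1, h2⟩ := Nat.mem_rfind.1 hx
    refine ⟨x, rfl, ?_, fun j hj => ?_⟩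
    · obtain ⟨y, hy, hy'⟩ := (Part.mem_map_iff _).1 h1
      have : y = 0 := by simpa using hy'
      exact this ▸ hy
    · obtain ⟨y, hy, hy'⟩ := (Part.mem_map_iff _).1 (h2 hj)
      exact ⟨y, by simpa using hy', hy⟩
  · rintro ⟨x, rfl, h1, h2⟩
    refine ⟨x, Nat.mem_rfind.2 ⟨(Part.mem_map_iff _).2 ⟨0, h1, by simp⟩, fun {j} hj => ?_⟩, rfl⟩
    obtain ⟨z, hz, hz'⟩ := h2 j hj
    exact (Part.mem_map_iff _).2 ⟨z, hz', by simpa using hz⟩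

theorem eval_mono (c : OracleCode) {g h : ℕ →. ℕ} (H : ∀ n v, v ∈ g n → v ∈ h n) :
    ∀ n v, v ∈ c.eval g n → v ∈ c.eval h n := by
  induction c with
  | zero => intro n v; exact id
  | succ => intro n v; exact id
  | left => intro n v; exact id
  | right => intro n v; exact id
  | oracle => exact H
  | pair a b iha ihb =>
    intro n v hv
    rw [mem_eval_pair] at hv ⊢
    obtain ⟨x, hx, y, hy, rfl⟩ := hv
    exact ⟨x, iha _ _ hx, y, ihb _ _ hy, rfl⟩
  | comp a b iha ihb =>
    intro n v hv
    rw [mem_eval_comp] at hv ⊢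
    obtain ⟨x, hx, hy⟩ := hv
    exact ⟨x, ihb _ _ hx, iha _ _ hy⟩
  | prec a b iha ihb =>
    intro n
    obtain ⟨p, k, rfl⟩ : ∃ p k, n = Nat.pair p k := ⟨n.unpair.1, n.unpair.2, by simp⟩
    induction k with
    | zero => intro v hv; rw [mem_eval_prec_zero] at hv ⊢; exact iha _ _ hv
    | succ k ih =>
      intro v hv
      rw [mem_eval_prec_succ] at hv ⊢
      obtain ⟨x, hx, hy⟩ := hv
      exact ⟨x, ih _ hx, ihb _ _ hy⟩
  | rfind' a iha =>
    intro n v hv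
    obtain ⟨p, k, rfl⟩ : ∃ p k, n = Nat.pair p k := ⟨n.unpair.1, n.unpair.2, by simp⟩
    rw [mem_eval_rfind] at hv ⊢
    obtain ⟨x, rfl, h1, h2⟩ := hv
    refine ⟨x, rfl, iha _ _ h1, fun j hj => ?_⟩
    obtain ⟨z, hz, hz'⟩ := h2 j hj
    exact ⟨z, hz, iha _ _ hz'⟩

theorem mem_strOracle {τ : List Bool} {n v : ℕ} :
    v ∈ strOracle τ n ↔ ∃ b, τ[n]? = some b ∧ v = cond b 1 0 := by
  unfold strOracle
  split <;> rename_i h <;> simp [h]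

theorem strOracle_mono {σ τ : List Bool} (h : σ <+: τ) (n v : ℕ) (hv : v ∈ strOracle σ n) :
    v ∈ strOracle τ n := by
  rw [mem_strOracle] at *
  obtain ⟨b, hb, rfl⟩ := hv
  obtain ⟨t, rfl⟩ := h
  refine ⟨b, ?_, rfl⟩
  grind

theorem strOracle_chi {X : ℕ → Bool} {τ : List Bool} (h : extendsStr X τ) (n v : ℕ)
    (hv : v ∈ strOracle τ n) : v ∈ chi X n := by
  rw [mem_strOracle] at hv
  obtain ⟨b, hb, rfl⟩ := hv
  simp [chi, h.getElem? hb]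

theorem eval_str_mono (c : OracleCode) {σ τ : List Bool} (h : σ <+: τ) {n v : ℕ}
    (hv : v ∈ c.eval (strOracle σ) n) : v ∈ c.eval (strOracle τ) n :=
  eval_mono c (strOracle_mono h) n v hv

theorem eval_str_chi (c : OracleCode) {X : ℕ → Bool} {τ : List Bool} (h : extendsStr X τ) {n v : ℕ}
    (hv : v ∈ c.eval (strOracle τ) n) : v ∈ c.eval (chi X) n :=
  eval_mono c (strOracle_chi h) n v hv

theorem eval_res_mono (c : OracleCode) (X : ℕ → Bool) {m m' : ℕ} (h : m ≤ m') {n v : ℕ}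
    (hv : v ∈ c.eval (strOracle (res X m)) n) : v ∈ c.eval (strOracle (res X m')) n :=
  eval_str_mono c (res_prefix X h) hv

theorem eval_cont (c : OracleCode) (X : ℕ → Bool) : ∀ n v, v ∈ c.eval (chi X) n →
    ∃ m, v ∈ c.eval (strOracle (res X m)) n := by
  induction c with
  | zero => intro n v h; exact ⟨0, h⟩
  | succ => intro n v h; exact ⟨0, h⟩
  | left => intro n v h; exact ⟨0, h⟩
  | right => intro n v h; exact ⟨0, h⟩
  | oracle =>
    intro n v h
    refine ⟨n + 1, ?_⟩
    simp only [OracleCode.eval, mem_strOracle]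
    simp only [OracleCode.eval, chi, Part.mem_some_iff] at h
    exact ⟨X n, by rw [res_getElem?]; simp, h⟩
  | pair a b iha ihb =>
    intro n v hv
    simp only [mem_eval_pair] at hv ⊢
    obtain ⟨x, hx, y, hy, rfl⟩ := hv
    obtain ⟨m, hm⟩ := iha _ _ hx
    obtain ⟨m', hm'⟩ := ihb _ _ hy
    exact ⟨max m m', x, eval_res_mono _ _ (le_max_left _ _) hm, y,
      eval_res_mono _ _ (le_max_right _ _) hm', rfl⟩
  | comp a b iha ihb =>
    intro n v hv
    simp only [mem_eval_comp] at hv ⊢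
    obtain ⟨x, hx, hy⟩ := hv
    obtain ⟨m, hm⟩ := ihb _ _ hx
    obtain ⟨m', hm'⟩ := iha _ _ hy
    exact ⟨max m m', x, eval_res_mono _ _ (le_max_left _ _) hm,
      eval_res_mono _ _ (le_max_right _ _) hm'⟩
  | prec a b iha ihb =>
    intro n
    obtain ⟨p, k, rfl⟩ : ∃ p k, n = Nat.pair p k := ⟨n.unpair.1, n.unpair.2, by simp⟩
    induction k with
    | zero =>
      intro v hv
      simp only [mem_eval_prec_zero] at hv ⊢
      exact iha _ _ hv
    | succ k ih =>
      intro v hv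
      simp only [mem_eval_prec_succ] at hv ⊢
      obtain ⟨x, hx, hy⟩ := hv
      obtain ⟨m, hm⟩ := ih _ hx
      obtain ⟨m', hm'⟩ := ihb _ _ hy
      exact ⟨max m m', x, eval_res_mono _ _ (le_max_left _ _) hm,
        eval_res_mono _ _ (le_max_right _ _) hm'⟩
  | rfind' a iha =>
    intro n v hv
    obtain ⟨p, k, rfl⟩ : ∃ p k, n = Nat.pair p k := ⟨n.unpair.1, n.unpair.2, by simp⟩
    simp only [mem_eval_rfind] at hv ⊢
    obtain ⟨x, rfl, hy, h2⟩ := hv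
    obtain ⟨m, hm⟩ := iha _ _ hy
    have key : ∀ i ≤ x, ∃ M, ∀ j < i, ∃ z, z ≠ 0 ∧ z ∈ a.eval (strOracle (res X M))
        (Nat.pair p (j + k)) := by
      intro i
      induction i with
      | zero => intro _; exact ⟨0, fun j hj => absurd hj (by omega)⟩
      | succ i ih =>
        intro hk
        obtain ⟨M, hM⟩ := ih (by omega)
        obtain ⟨z, hz, hz'⟩ := h2 i (by omega)
        obtain ⟨M', hM'⟩ := iha _ _ hz'
        refine ⟨max M M', fun j hj => ?_⟩
        rcases Nat.lt_succ_iff_lt_or_eq.1 hj with h | rfl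
        · obtain ⟨z, hz, hz'⟩ := hM j h
          exact ⟨z, hz, eval_res_mono _ _ (le_max_left _ _) hz'⟩
        · exact ⟨z, hz, eval_res_mono _ _ (le_max_right _ _) hM'⟩
    obtain ⟨M, hM⟩ := key x le_rfl
    refine ⟨max m M, x, rfl, eval_res_mono _ _ (le_max_left _ _) hm, fun j hj => ?_⟩
    obtain ⟨z, hz, hz'⟩ := hM j hj
    exact ⟨z, hz, eval_res_mono _ _ (le_max_right _ _) hz'⟩

/-! ### Effectiveness of string oracles -/

theorem eval_partrec (c : OracleCode) :
    Partrec fun p : List Bool × ℕ => c.eval (strOracle p.1) p.2 := by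
  have hpair : Computable₂ Nat.pair := Primrec₂.natPair.to_comp
  induction c with
  | zero => exact Computable.const 0
  | succ => exact Computable.succ.comp Computable.snd
  | left => exact (Primrec.fst.comp (Primrec.unpair.comp Primrec.snd)).to_comp
  | right => exact (Primrec.snd.comp (Primrec.unpair.comp Primrec.snd)).to_comp
  | oracle =>
    have : Primrec fun p : List Bool × ℕ => (p.1[p.2]?).map (fun b => cond b 1 0) :=
      Primrec.option_map (Primrec.list_getElem?.comp Primrec.fst Primrec.snd)
        ((Primrec.cond Primrec.snd (Primrec.const 1) (Primrec.const 0)).to₂)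
    refine (Computable.ofOption this.to_comp).of_eq fun p => ?_
    apply Part.ext
    intro v
    simp only [OracleCode.eval, mem_strOracle]
    simp [eq_comm]
  | pair a b iha ihb =>
    have h1 : Partrec₂ fun (p : List Bool × ℕ) (x : ℕ) =>
        (b.eval (strOracle p.1) p.2).map (fun y => Nat.pair x y) :=
      (Partrec.map (ihb.comp Computable.fst)
        (hpair.comp (Computable.snd.comp Computable.fst) Computable.snd).to₂)
    refine (iha.bind h1).of_eq fun p => ?_
    apply Part.ext
    intro v
    rw [mem_eval_pair]
    simp only [Part.mem_bind_iff, Part.mem_map_iff, eq_comm]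
  | comp a b iha ihb =>
    refine (ihb.bind (iha.comp ((Computable.fst.comp Computable.fst).pair Computable.snd)).to₂).of_eq
      fun p => ?_
    rfl
  | prec a b iha ihb =>
    have h1 : Computable fun p : List Bool × ℕ => p.2.unpair.1 :=
      (Primrec.fst.comp (Primrec.unpair.comp Primrec.snd)).to_comp
    have h2 : Computable fun p : List Bool × ℕ => p.2.unpair.2 :=
      (Primrec.snd.comp (Primrec.unpair.comp Primrec.snd)).to_comp
    refine (Partrec.nat_rec h2 (iha.comp (Computable.fst.pair h1))
      (ihb.comp ((Computable.fst.comp Computable.fst).pair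
        (hpair.comp (h1.comp Computable.fst) (hpair.comp (Computable.fst.comp Computable.snd)
          (Computable.snd.comp Computable.snd))))).to₂).of_eq fun p => ?_
    rfl
  | rfind' a iha =>
    have h1 : Computable fun p : List Bool × ℕ => p.2.unpair.1 :=
      (Primrec.fst.comp (Primrec.unpair.comp Primrec.snd)).to_comp
    have h2 : Computable fun p : List Bool × ℕ => p.2.unpair.2 :=
      (Primrec.snd.comp (Primrec.unpair.comp Primrec.snd)).to_comp
    have hadd : Computable₂ ((· + ·) : ℕ → ℕ → ℕ) := Primrec.nat_add.to_comp
    have hz : Computable fun m : ℕ => decide (m = 0) :=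
      (PrimrecPred.decide (Primrec.eq.comp Primrec.id (Primrec.const 0))).to_comp
    refine (Partrec.map (Partrec.rfind (p := fun (p : List Bool × ℕ) (n : ℕ) =>
        (a.eval (strOracle p.1) (Nat.pair p.2.unpair.1 (n + p.2.unpair.2))).map
          (fun m => decide (m = 0))) ?_)
      (hadd.comp Computable.snd (h2.comp Computable.fst)).to₂).of_eq fun p => ?_
    · exact Partrec.map (iha.comp ((Computable.fst.comp Computable.fst).pair
        (hpair.comp (h1.comp Computable.fst) (hadd.comp Computable.snd (h2.comp Computable.fst)))))
        (hz.comp Computable.snd).to₂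
    · rfl

open Encodable

/-! ### Semidecidable predicates -/

section Sig

variable {α β γ : Type} [Primcodable α] [Primcodable β] [Primcodable γ]

theorem pp_ex_mem {R : α → β → Prop} (hR : PrimrecPred fun p : α × β => R p.1 p.2)
    {l : α → List β} (hl : Primrec l) : PrimrecPred fun a => ∃ b ∈ l a, R a b := by
  have h1 : PrimrecRel fun (b : β) (a : α) => R a b := hR.comp (Primrec.snd.pair Primrec.fst)
  exact h1.exists_mem_list.comp hl Primrec.id

theorem pp_all_mem {R : α → β → Prop} (hR : PrimrecPred fun p : α × β => R p.1 p.2)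
    {l : α → List β} (hl : Primrec l) : PrimrecPred fun a => ∀ b ∈ l a, R a b := by
  have h1 : PrimrecRel fun (b : β) (a : α) => R a b := hR.comp (Primrec.snd.pair Primrec.fst)
  exact h1.forall_mem_list.comp hl Primrec.id

/-- Semidecidable predicates, presented through a primitive recursive matrix. -/
def Sig (R : α → Prop) : Prop :=
  ∃ D : α × ℕ → Prop, PrimrecPred D ∧ ∀ a, R a ↔ ∃ w, D (a, w)

theorem Sig.of_iff {R S : α → Prop} (h : Sig R) (H : ∀ a, S a ↔ R a) : Sig S := by
  obtain ⟨D, hD, hd⟩ := h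
  exact ⟨D, hD, fun a => (H a).trans (hd a)⟩

theorem Sig.of_prim {R : α → Prop} (h : PrimrecPred R) : Sig R :=
  ⟨fun p => R p.1, h.comp Primrec.fst, fun a => by simp⟩

theorem Sig.comp {R : β → Prop} (h : Sig R) {f : α → β} (hf : Primrec f) :
    Sig fun a => R (f a) := by
  obtain ⟨D, hD, hd⟩ := h
  exact ⟨fun p => D (f p.1, p.2), hD.comp ((hf.comp Primrec.fst).pair Primrec.snd),
    fun a => hd _⟩

theorem Sig.mono {R : α → Prop} (h : Sig R) : ∃ D : α × ℕ → Prop, PrimrecPred D ∧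
    (∀ a w w', w ≤ w' → D (a, w) → D (a, w')) ∧ ∀ a, R a ↔ ∃ w, D (a, w) := by
  obtain ⟨D, hD, hd⟩ := h
  refine ⟨fun p => ∃ w ∈ List.range (p.2 + 1), D (p.1, w), ?_, ?_, fun a => ?_⟩
  · exact pp_ex_mem (R := fun (p : α × ℕ) w => D (p.1, w))
      (hD.comp ((Primrec.fst.comp Primrec.fst).pair Primrec.snd))
      (Primrec.list_range.comp (Primrec.succ.comp Primrec.snd))
  · rintro a w w' hw ⟨x, hx, h⟩
    exact ⟨x, by simp at hx ⊢; omega, h⟩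
  · rw [hd]
    constructor
    · rintro ⟨w, h⟩; exact ⟨w, w, by simp, h⟩
    · rintro ⟨w, x, _, h⟩; exact ⟨x, h⟩

theorem Sig.and {R S : α → Prop} (hR : Sig R) (hS : Sig S) : Sig fun a => R a ∧ S a := by
  obtain ⟨D, hD, hm, hd⟩ := hR.mono
  obtain ⟨E, hE, hn, he⟩ := hS.mono
  refine ⟨fun p => D p ∧ E p, hD.and hE, fun a => ?_⟩
  simp only [hd, he]
  constructor
  · rintro ⟨⟨w, h⟩, w', h'⟩
    exact ⟨max w w', hm _ _ _ (le_max_left _ _) h, hn _ _ _ (le_max_right _ _) h'⟩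
  · rintro ⟨w, h, h'⟩; exact ⟨⟨w, h⟩, w, h'⟩

theorem Sig.or {R S : α → Prop} (hR : Sig R) (hS : Sig S) : Sig fun a => R a ∨ S a := by
  obtain ⟨D, hD, hd⟩ := hR
  obtain ⟨E, hE, he⟩ := hS
  refine ⟨fun p => D p ∨ E p, hD.or hE, fun a => ?_⟩
  simp only [hd, he, exists_or]

theorem prim_toList : Primrec fun o : Option β => o.toList := by
  refine (Primrec.option_casesOn (Primrec.id (α := Option β)) (Primrec.const [])
    (Primrec.list_cons.comp Primrec.snd (Primrec.const [])).to₂).of_eq fun o => ?_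
  cases o <;> rfl

theorem Sig.ex {R : α → β → Prop} (h : Sig fun p : α × β => R p.1 p.2) :
    Sig fun a => ∃ b, R a b := by
  obtain ⟨D, hD, hd⟩ := h
  refine ⟨fun p => ∃ b ∈ (decode (α := β) p.2.unpair.1).toList, D ((p.1, b), p.2.unpair.2),
    ?_, fun a => ?_⟩
  · refine pp_ex_mem (R := fun (p : α × ℕ) b => D ((p.1, b), p.2.unpair.2)) ?_ ?_
    · exact hD.comp (((Primrec.fst.comp Primrec.fst).pair Primrec.snd).pair
        (Primrec.snd.comp (Primrec.unpair.comp (Primrec.snd.comp Primrec.fst))))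
    · exact prim_toList.comp (Primrec.decode.comp
        (Primrec.fst.comp (Primrec.unpair.comp Primrec.snd)))
  · constructor
    · rintro ⟨b, hb⟩
      obtain ⟨w, hw⟩ := (hd (a, b)).1 hb
      exact ⟨Nat.pair (encode b) w, b, by simp, by simpa using hw⟩
    · rintro ⟨w, b, _, hw⟩
      exact ⟨b, (hd (a, b)).2 ⟨_, hw⟩⟩

theorem Sig.all_mem {R : α → β → Prop} (h : Sig fun p : α × β => R p.1 p.2)
    {l : α → List β} (hl : Primrec l) : Sig fun a => ∀ b ∈ l a, R a b := by
  obtain ⟨D, hD, hm, hd⟩ := h.mono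
  refine ⟨fun p => ∀ b ∈ l p.1, D ((p.1, b), p.2), ?_, fun a => ?_⟩
  · exact pp_all_mem (R := fun (p : α × ℕ) b => D ((p.1, b), p.2))
      (hD.comp (((Primrec.fst.comp Primrec.fst).pair Primrec.snd).pair
        (Primrec.snd.comp Primrec.fst))) (hl.comp Primrec.fst)
  · constructor
    · intro H
      change ∀ b ∈ l a, R a b at H
      change ∃ w, ∀ b ∈ l a, D ((a, b), w)
      generalize l a = L at H
      induction L with
      | nil => exact ⟨0, by simp⟩
      | cons x L ih =>
        obtain ⟨w, hw⟩ := ih fun b hb => H b (by simp [hb])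
        obtain ⟨w', hw'⟩ := (hd (a, x)).1 (H x (by simp))
        refine ⟨max w w', fun b hb => ?_⟩
        rcases List.mem_cons.1 hb with rfl | hb
        · exact hm _ _ _ (le_max_right _ _) hw'
        · exact hm _ _ _ (le_max_left _ _) (hw b hb)
    · rintro ⟨w, hw⟩ b hb
      exact (hd (a, b)).2 ⟨w, hw b hb⟩

theorem Sig.of_partrec {f : α →. β} (hf : Partrec f) : Sig fun p : α × β => p.2 ∈ f p.1 := by
  obtain ⟨c, hc⟩ := Nat.Partrec.Code.exists_code.1 hf
  refine ⟨fun p => Nat.Partrec.Code.evaln p.2 c (encode p.1.1) = some (encode p.1.2),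
    ?_, fun a => ?_⟩
  · exact Primrec.eq.comp (Nat.Partrec.Code.primrec_evaln.comp
      ((Primrec.snd.pair (Primrec.const c)).pair
        (Primrec.encode.comp (Primrec.fst.comp Primrec.fst))))
      (Primrec.option_some.comp (Primrec.encode.comp (Primrec.snd.comp Primrec.fst)))
  · have h1 : (∃ w, Nat.Partrec.Code.evaln w c (encode a.1) = some (encode a.2)) ↔
        encode a.2 ∈ c.eval (encode a.1) := Nat.Partrec.Code.evaln_complete.symm
    simp only [h1, hc]
    simp

/-- Primitive recursive functions are computed by codes, whatever the oracle. -/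
theorem prim_code {f : α → β} (hf : Primrec f) (g : ℕ →. ℕ) :
    ∃ c : OracleCode, ∀ a, encode (f a) ∈ c.eval g (encode a) := by
  obtain ⟨c, hc⟩ := exists_oracleCode hf.to_comp g
  refine ⟨c, fun a => ?_⟩
  rw [hc]; simp

end Sig

theorem Sig.ce {W : Set (List Bool)} (h : Sig fun σ => σ ∈ W) : CE W := by
  obtain ⟨D, hD, hd⟩ := h
  classical
  have h1 : Partrec fun σ : List Bool => Nat.rfind fun w => (Part.some (decide (D (σ, w)))) :=
    Partrec.rfind (p := fun σ w => Part.some (decide (D (σ, w)))) hD.decide.to_comp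
  obtain ⟨c, hc⟩ := exists_oracleCode h1 (chi fun _ => false)
  refine ⟨c, fun σ => ?_⟩
  have h2 := hd σ
  change σ ∈ W ↔ _ at h2
  have h3 : c.eval (chi fun _ => false) (encode σ) = ((decode (α := List Bool) (encode σ) : Part _)).bind
      fun a => Part.map encode (Nat.rfind fun w => (Part.some (decide (D (a, w))))) := by rw [hc]
  rw [h2, h3, encodek]
  constructor
  · rintro ⟨w, hw⟩
    obtain ⟨n, hn, -⟩ := Nat.rfind_min' (p := fun w => decide (D (σ, w))) (m := w) (by simpa using hw)
    have : encode n ∈ ((some σ : Option (List Bool)) : Part _).bind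
      fun a => Part.map encode (Nat.rfind fun w => (Part.some (decide (D (a, w))))) :=
      Part.mem_bind (Part.mem_some _) (Part.mem_map _ hn)
    exact this.1
  · intro h
    obtain ⟨v, hv⟩ := Part.dom_iff_mem.1 h
    obtain ⟨a, ha, hv⟩ := Part.mem_bind_iff.1 hv
    obtain ⟨w, hw, -⟩ := (Part.mem_map_iff _).1 hv
    have h4 := Nat.rfind_spec hw
    have : a = σ := by simpa using ha
    subst this
    exact ⟨w, by simpa using h4⟩

theorem sig_eval (c : OracleCode) :
    Sig fun p : List Bool × ℕ × ℕ => p.2.2 ∈ c.eval (strOracle p.1) p.2.1 :=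
  (Sig.of_partrec (eval_partrec c)).comp
    ((Primrec.fst.pair (Primrec.fst.comp Primrec.snd)).pair (Primrec.snd.comp Primrec.snd))

/-- A code producing initial segments of the oracle. -/
theorem exists_res_code (X : ℕ → Bool) :
    ∃ c : OracleCode, ∀ m, encode (res X m) ∈ c.eval (chi X) (Nat.pair 0 m) := by
  have hs : Primrec fun p : List Bool × ℕ => p.1 ++ [decide (p.2 = 1)] :=
    Primrec.list_append.comp Primrec.fst (Primrec.list_cons.comp
      (PrimrecPred.decide (Primrec.eq.comp Primrec.snd (Primrec.const 1))) (Primrec.const []))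
  obtain ⟨s, hs⟩ := prim_code hs (chi X)
  refine ⟨.prec .zero (.comp s (.pair (.comp .right .right) (.comp .oracle (.comp .left .right)))),
    fun m => ?_⟩
  induction m with
  | zero =>
    rw [mem_eval_prec_zero]
    simp [OracleCode.eval, res]
    exact ⟨trivial, rfl⟩
  | succ m ih =>
    rw [mem_eval_prec_succ]
    refine ⟨_, ih, ?_⟩
    rw [mem_eval_comp]
    refine ⟨Nat.pair (encode (res X m)) (cond (X m) 1 0), ?_, ?_⟩
    · rw [mem_eval_pair]
      refine ⟨_, ?_, _, ?_, rfl⟩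
      · rw [mem_eval_comp]
        exact ⟨Nat.pair m (encode (res X m)), by simp [OracleCode.eval], by simp [OracleCode.eval]⟩
      · rw [mem_eval_comp]
        refine ⟨m, ?_, by simp [OracleCode.eval, chi]⟩
        rw [mem_eval_comp]
        exact ⟨Nat.pair m (encode (res X m)), by simp [OracleCode.eval], by simp [OracleCode.eval]⟩
    · have := hs (res X m, cond (X m) 1 0)
      rw [res_succ]
      cases h : X m <;> simpa [h] using this

/-- Reductions from semidecidable graphs. -/
theorem tred_of_sig (X b : ℕ → Bool) (G : List Bool × ℕ × Bool → Prop) (hG : Sig G)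
    (h1 : ∀ i, ∃ m, G (res X m, i, b i)) (h2 : ∀ i m v, G (res X m, i, v) → v = b i) :
    TRed b X := by
  classical
  obtain ⟨D, hD, hd⟩ := hG
  obtain ⟨r, hr⟩ := exists_res_code X
  have ht : Primrec fun p : List Bool × ℕ × ℕ =>
      if D ((p.1, p.2.1, decide (p.2.2.unpair.2.unpair.1 = 1)), p.2.2.unpair.2.unpair.2)
        then 0 else 1 := by
    have e : Primrec fun p : List Bool × ℕ × ℕ => p.2.2.unpair.2.unpair :=
      Primrec.unpair.comp (Primrec.snd.comp (Primrec.unpair.comp (Primrec.snd.comp Primrec.snd)))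
    refine Primrec.ite (hD.comp (Primrec.pair (Primrec.pair Primrec.fst (Primrec.pair
      (Primrec.fst.comp Primrec.snd) (PrimrecPred.decide
        (Primrec.eq.comp (Primrec.fst.comp e) (Primrec.const 1)))))
      (Primrec.snd.comp e))) (Primrec.const 0) (Primrec.const 1)
  obtain ⟨t, ht⟩ := prim_code ht (chi X)
  have hp : Primrec fun n : ℕ => if n.unpair.2.unpair.1 = 1 then 1 else 0 :=
    Primrec.ite (Primrec.eq.comp (Primrec.fst.comp (Primrec.unpair.comp (Primrec.snd.comp
      Primrec.unpair))) (Primrec.const 1)) (Primrec.const 1) (Primrec.const 0)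
  obtain ⟨p, hp⟩ := prim_code hp (chi X)
  obtain ⟨idc, hid⟩ := prim_code (Primrec.id (α := ℕ)) (chi X)
  obtain ⟨zc, hz⟩ := prim_code (Primrec.const (α := ℕ) 0) (chi X)
  simp only [encode_nat, id] at hid hz hp
  -- the test
  let T : ℕ → ℕ → Prop := fun i n =>
    D ((res X n.unpair.1, i, decide (n.unpair.2.unpair.1 = 1)), n.unpair.2.unpair.2)
  let tc : OracleCode :=
    .comp t (.pair (.comp r (.pair zc (.comp .left .right))) idc)
  have htc : ∀ i n, (if T i n then 0 else 1) ∈ tc.eval (chi X) (Nat.pair i n) := by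
    intro i n
    simp only [tc]
    rw [mem_eval_comp]
    refine ⟨Nat.pair (encode (res X n.unpair.1)) (Nat.pair i n), ?_, ?_⟩
    · rw [mem_eval_pair]
      refine ⟨_, ?_, _, hid _, rfl⟩
      rw [mem_eval_comp]
      refine ⟨_, ?_, hr _⟩
      rw [mem_eval_pair]
      refine ⟨_, hz _, _, ?_, rfl⟩
      rw [mem_eval_comp]
      exact ⟨n, by simp [OracleCode.eval], by simp [OracleCode.eval]⟩
    · have := ht (res X n.unpair.1, i, n)
      simpa [T] using this
  have hex : ∀ i, ∃ n, T i n := by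
    intro i
    obtain ⟨m, hm⟩ := h1 i
    obtain ⟨w, hw⟩ := (hd _).1 hm
    refine ⟨Nat.pair m (Nat.pair (cond (b i) 1 0) w), ?_⟩
    cases hb : b i <;> simpa [T, hb] using hw
  refine ⟨.comp p (.comp (.rfind' tc) (.pair idc zc)), ?_⟩
  funext i
  refine Part.eq_some_iff.2 ?_
  have hs := Nat.find_spec (hex i)
  set n := Nat.find (hex i) with hn
  have hmin : ∀ j < n, ¬ T i j := fun j hj => Nat.find_min (hex i) hj
  rw [mem_eval_comp]
  refine ⟨n, ?_, ?_⟩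
  · rw [mem_eval_comp]
    refine ⟨Nat.pair i 0, ?_, ?_⟩
    · rw [mem_eval_pair]
      exact ⟨_, hid _, _, hz _, rfl⟩
    · rw [mem_eval_rfind]
      refine ⟨n, rfl, ?_, fun j hj => ⟨1, one_ne_zero, ?_⟩⟩
      · have := htc i n
        rwa [if_pos hs] at this
      · have := htc i j
        rwa [if_neg (hmin j hj)] at this
  · have h3 := h2 _ _ _ ((hd _).2 ⟨_, hs⟩)
    have := hp n
    rw [← h3]
    by_cases h : n.unpair.2.unpair.1 = 1 <;> simpa [h] using this

/-! ### The construction -/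

/-- The quadruple coded by a token. -/
def tok (k : ℕ) : List Bool × List Bool × List Bool × ℕ :=
  (decode (α := List Bool × List Bool × List Bool × ℕ) k).getD ([], [], [], 0)

/-- The padding string attached to a token. -/
def pad (k : ℕ) : List Bool := (List.range k).map (fun _ => false) ++ [true]

open Classical in
/-- The closers of the string `r` for the token `k`. -/
noncomputable def clo (r : List Bool) (k : ℕ) : List (List Bool) :=
  if r = (tok k).1 then [(tok k).2.1 ++ true :: pad k, (tok k).2.2.1 ++ true :: pad k]
  else [r ++ false :: pad k]

/-- The token `k` may be added given the partition `P` and the list `L` of earlier tokens. -/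
def okTok (spl : List Bool × List Bool × ℕ → Prop) (P : List (List Bool)) (L : List ℕ) (k : ℕ) :
    Prop :=
  (tok k).1 ∈ P ∧ (tok k).1 <+: (tok k).2.1 ∧ (tok k).1 <+: (tok k).2.2.1 ∧
    (tok k).2.1.length ≤ k ∧ (tok k).2.2.1.length ≤ k ∧ spl (tok k).2 ∧
    ∀ m ∈ L, ∀ r ∈ P, ∀ u ∈ clo r k, ∀ v ∈ clo r m, ¬ u <+: v ∧ ¬ v <+: u

open Classical in
/-- The accepted tokens below a bound. -/
noncomputable def accList (spl : List Bool × List Bool × ℕ → Prop) (P : List (List Bool)) (n : ℕ) :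
    List ℕ :=
  Nat.rec [] (fun k L => if okTok spl P L k then k :: L else L) n

/-- The token `k` is accepted for the partition `P`. -/
def acc (spl : List Bool × List Bool × ℕ → Prop) (P : List (List Bool)) (k : ℕ) : Prop :=
  okTok spl P (accList spl P k) k

open Classical in
/-- The partition determined by a sequence of tokens (latest first). -/
noncomputable def PV (spl : List Bool × List Bool × ℕ → Prop) (K : List ℕ) :
    Option (List (List Bool)) :=
  K.foldr (fun k o => o.bind fun P =>
    if acc spl P k then some (P.flatMap fun r => clo r k) else none) (some [[]])

/-! ### Effectiveness of the construction -/

section Prim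

variable {α : Type} [Primcodable α]

theorem prim_tok : Primrec tok :=
  Primrec.option_getD.comp Primrec.decode (Primrec.const _)

theorem prim_pad : Primrec pad :=
  Primrec.list_append.comp (Primrec.list_map Primrec.list_range (Primrec.const false).to₂)
    (Primrec.const [true])

theorem pp_prefix {f g : α → List Bool} (hf : Primrec f) (hg : Primrec g) :
    PrimrecPred fun a => f a <+: g a := by
  refine (Primrec.eq.comp (Primrec.list_take.comp (Primrec.list_length.comp hf) hg) hf).of_eq
    fun a => ?_
  rw [List.prefix_iff_eq_take, eq_comm]

theorem pp_mem {β : Type} [Primcodable β] {f : α → β} {l : α → List β} (hf : Primrec f)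
    (hl : Primrec l) : PrimrecPred fun a => f a ∈ l a := by
  refine (pp_ex_mem (R := fun a b => b = f a)
    (Primrec.eq.comp Primrec.snd (hf.comp Primrec.fst)) hl).of_eq fun a => ?_
  simp

theorem prim_clo : Primrec₂ clo := by
  have h1 : Primrec fun p : List Bool × ℕ => tok p.2 := prim_tok.comp Primrec.snd
  have h2 : Primrec fun p : List Bool × ℕ => pad p.2 := prim_pad.comp Primrec.snd
  refine Primrec.ite (Primrec.eq.comp Primrec.fst (Primrec.fst.comp h1)) ?_ ?_
  · refine Primrec.list_cons.comp ?_ (Primrec.list_cons.comp ?_ (Primrec.const []))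
    · exact Primrec.list_append.comp (Primrec.fst.comp (Primrec.snd.comp h1))
        (Primrec.list_cons.comp (Primrec.const true) h2)
    · exact Primrec.list_append.comp (Primrec.fst.comp (Primrec.snd.comp (Primrec.snd.comp h1)))
        (Primrec.list_cons.comp (Primrec.const true) h2)
  · refine Primrec.list_cons.comp ?_ (Primrec.const [])
    exact Primrec.list_append.comp Primrec.fst (Primrec.list_cons.comp (Primrec.const false) h2)

variable {spl : List Bool × List Bool × ℕ → Prop}

theorem pp_okTok (hs : PrimrecPred spl) :
    PrimrecPred fun p : List (List Bool) × List ℕ × ℕ => okTok spl p.1 p.2.1 p.2.2 := by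
  have hk : Primrec fun p : List (List Bool) × List ℕ × ℕ => p.2.2 :=
    Primrec.snd.comp Primrec.snd
  have ht : Primrec fun p : List (List Bool) × List ℕ × ℕ => tok p.2.2 := prim_tok.comp hk
  have h1 := Primrec.fst.comp ht
  have hx := Primrec.snd.comp ht
  have h2 := Primrec.fst.comp hx
  have h3 := Primrec.fst.comp (Primrec.snd.comp hx)
  refine (pp_mem h1 Primrec.fst).and ((pp_prefix h1 h2).and ((pp_prefix h1 h3).and
    ((Primrec.nat_le.comp (Primrec.list_length.comp h2) hk).and
    ((Primrec.nat_le.comp (Primrec.list_length.comp h3) hk).and ((hs.comp hx).and ?_)))))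
  refine pp_all_mem (R := fun (p : List (List Bool) × List ℕ × ℕ) (m : ℕ) =>
    ∀ r ∈ p.1, ∀ u ∈ clo r p.2.2, ∀ v ∈ clo r m, ¬ u <+: v ∧ ¬ v <+: u) ?_
    (Primrec.fst.comp Primrec.snd)
  refine pp_all_mem (R := fun (p : (List (List Bool) × List ℕ × ℕ) × ℕ) (r : List Bool) =>
    ∀ u ∈ clo r p.1.2.2, ∀ v ∈ clo r p.2, ¬ u <+: v ∧ ¬ v <+: u) ?_
    (Primrec.fst.comp Primrec.fst)
  refine pp_all_mem (R := fun (p : ((List (List Bool) × List ℕ × ℕ) × ℕ) × List Bool)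
    (u : List Bool) => ∀ v ∈ clo p.2 p.1.2, ¬ u <+: v ∧ ¬ v <+: u) ?_
    (prim_clo.comp Primrec.snd (hk.comp (Primrec.fst.comp Primrec.fst)))
  refine pp_all_mem (R := fun (p : (((List (List Bool) × List ℕ × ℕ) × ℕ) × List Bool) × List Bool)
    (v : List Bool) => ¬ p.2 <+: v ∧ ¬ v <+: p.2) ?_
    (prim_clo.comp (Primrec.snd.comp Primrec.fst)
      (Primrec.snd.comp (Primrec.fst.comp Primrec.fst)))
  exact (pp_prefix (Primrec.snd.comp Primrec.fst) Primrec.snd).not.and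
    (pp_prefix Primrec.snd (Primrec.snd.comp Primrec.fst)).not

theorem prim_accList (hs : PrimrecPred spl) : Primrec₂ (accList spl) := by
  classical
  refine Primrec.nat_rec (f := fun _ : List (List Bool) => ([] : List ℕ))
    (g := fun P (q : ℕ × List ℕ) => if okTok spl P q.2 q.1 then q.1 :: q.2 else q.2)
    (Primrec.const []) ?_ |>.of_eq ?_
  · have hq1 : Primrec fun p : List (List Bool) × ℕ × List ℕ => p.2.1 :=
      Primrec.fst.comp Primrec.snd
    have hq2 : Primrec fun p : List (List Bool) × ℕ × List ℕ => p.2.2 :=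
      Primrec.snd.comp Primrec.snd
    exact Primrec.ite ((pp_okTok hs).comp (Primrec.fst.pair (hq2.pair hq1)))
      (Primrec.list_cons.comp hq1 hq2) hq2
  · intro P n
    unfold accList
    congr!

theorem pp_acc (hs : PrimrecPred spl) :
    PrimrecPred fun p : List (List Bool) × ℕ => acc spl p.1 p.2 :=
  (pp_okTok hs).comp (Primrec.fst.pair
    (((prim_accList hs).comp Primrec.fst Primrec.snd).pair Primrec.snd))

theorem prim_PV (hs : PrimrecPred spl) : Primrec (PV spl) := by
  classical
  have hstep : Primrec fun p : List (List Bool) × ℕ =>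
      if acc spl p.1 p.2 then some (p.1.flatMap fun r => clo r p.2) else none :=
    Primrec.ite (pp_acc hs) (Primrec.option_some.comp (Primrec.list_flatMap Primrec.fst
      (prim_clo.comp Primrec.snd (Primrec.snd.comp Primrec.fst)).to₂)) (Primrec.const none)
  refine (Primrec.list_foldr (f := fun K : List ℕ => K) (g := fun _ => some [[]])
    (h := fun _ (q : ℕ × Option (List (List Bool))) => q.2.bind fun P =>
      if acc spl P q.1 then some (P.flatMap fun r => clo r q.1) else none)
    Primrec.id (Primrec.const _) ?_).of_eq ?_
  · refine Primrec.option_bind (Primrec.snd.comp Primrec.snd) ?_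
    exact (hstep.comp (Primrec.snd.pair (Primrec.fst.comp (Primrec.snd.comp Primrec.fst)))).to₂
  · intro K
    unfold PV
    congr!

end Prim

/-! ### Basic combinatorics of the construction -/

theorem pad_eq (k : ℕ) : pad k = List.replicate k false ++ [true] := by
  simp [pad, List.map_const']

theorem tok_surj (q x0 x1 : List Bool) (w : ℕ) :
    ∃ k, w ≤ k ∧ tok k = (q, x0, x1, w) := by
  refine ⟨encode (q, x0, x1, w), ?_, by simp [tok]⟩
  simp only [Encodable.encode_prod_val, encode_nat]
  exact (Nat.right_le_pair _ _).trans ((Nat.right_le_pair _ _).trans (Nat.right_le_pair _ _))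

section Comb

variable {spl : List Bool × List Bool × ℕ → Prop}

open Classical in
theorem accList_succ (P : List (List Bool)) (k : ℕ) :
    accList spl P (k + 1) = if acc spl P k then k :: accList spl P k else accList spl P k := by
  rfl

theorem mem_accList {P : List (List Bool)} {k m : ℕ} :
    m ∈ accList spl P k ↔ m < k ∧ acc spl P m := by
  induction k with
  | zero => simp [accList]
  | succ k ih =>
    rw [accList_succ]
    split
    · rename_i h
      rw [List.mem_cons, ih]
      constructor
      · rintro (rfl | ⟨h1, h2⟩)
        · exact ⟨by omega, h⟩
        · exact ⟨by omega, h2⟩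
      · rintro ⟨h1, h2⟩
        rcases Nat.lt_succ_iff_lt_or_eq.1 h1 with h | h
        · exact Or.inr ⟨h, h2⟩
        · exact Or.inl h
    · rename_i h
      rw [ih]
      constructor
      · rintro ⟨h1, h2⟩
        exact ⟨by omega, h2⟩
      · rintro ⟨h1, h2⟩
        rcases Nat.lt_succ_iff_lt_or_eq.1 h1 with h' | h'
        · exact ⟨h', h2⟩
        · exact absurd (h' ▸ h2) h

theorem PV_nil : PV spl [] = some [[]] := rfl

theorem PV_cons {k : ℕ} {K : List ℕ} {Q : List (List Bool)} :
    PV spl (k :: K) = some Q ↔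
      ∃ P, PV spl K = some P ∧ acc spl P k ∧ Q = P.flatMap fun r => clo r k := by
  unfold PV
  rw [List.foldr_cons, Option.bind_eq_some_iff]
  constructor
  · rintro ⟨P, h1, h2⟩
    split at h2
    · exact ⟨P, h1, by assumption, by simpa [eq_comm] using h2⟩
    · simp at h2
  · rintro ⟨P, h1, h2, rfl⟩
    exact ⟨P, h1, by rw [if_pos h2]⟩

theorem clo_own {q : List Bool} {k : ℕ} (h : (tok k).1 = q) :
    clo q k = [(tok k).2.1 ++ true :: pad k, (tok k).2.2.1 ++ true :: pad k] := by
  unfold clo; rw [if_pos h.symm]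

theorem clo_other {q : List Bool} {k : ℕ} (h : (tok k).1 ≠ q) :
    clo q k = [q ++ false :: pad k] := by
  unfold clo; rw [if_neg h.symm]

theorem clo_nonempty (r : List Bool) (k : ℕ) : ∃ u, u ∈ clo r k := by
  by_cases h : (tok k).1 = r
  · rw [clo_own h]; exact ⟨_, List.mem_cons_self⟩
  · rw [clo_other h]; exact ⟨_, List.mem_cons_self⟩

theorem clo_ext {P : List (List Bool)} {k : ℕ} (hk : acc spl P k) {r u : List Bool}
    (hu : u ∈ clo r k) : r <+: u ∧ r.length < u.length := by
  by_cases h : (tok k).1 = r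
  · rw [clo_own h] at hu
    have h1 := hk.2.1
    have h2 := hk.2.2.1
    rw [h] at h1 h2
    have h3 := h1.length_le
    have h4 := h2.length_le
    simp only [List.mem_cons, List.not_mem_nil, or_false] at hu
    rcases hu with rfl | rfl
    · exact ⟨h1.trans (List.prefix_append _ _), by simp; omega⟩
    · exact ⟨h2.trans (List.prefix_append _ _), by simp; omega⟩
  · rw [clo_other h] at hu
    simp only [List.mem_cons, List.not_mem_nil, or_false] at hu
    subst hu
    exact ⟨List.prefix_append _ _, by simp⟩

theorem SplitPair.mono {c : OracleCode} {x y x' y' : List Bool} (h : SplitPair c x y)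
    (hx : x <+: x') (hy : y <+: y') : SplitPair c x' y' := by
  obtain ⟨n, a, b, ha, hb, hab⟩ := h
  exact ⟨n, a, b, eval_str_mono c hx ha, eval_str_mono c hy hb, hab⟩

theorem SplitPair.symm {c : OracleCode} {x y : List Bool} (h : SplitPair c x y) :
    SplitPair c y x := by
  obtain ⟨n, a, b, ha, hb, hab⟩ := h
  exact ⟨n, b, a, hb, ha, hab.symm⟩

theorem SplitPair.irrefl {c : OracleCode} {x : List Bool} (h : SplitPair c x x) : False := by
  obtain ⟨n, a, b, ha, hb, hab⟩ := h
  exact hab (Part.mem_unique ha hb)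

theorem SplitPair.not_prefix {c : OracleCode} {x y : List Bool} (h : SplitPair c x y) :
    ¬ x <+: y := fun hxy => (h.mono hxy List.prefix_rfl).irrefl

variable {Ψ : OracleCode}

theorem PV_split (hsp : ∀ x y w, spl (x, y, w) → SplitPair Ψ x y) :
    ∀ {K : List ℕ} {P : List (List Bool)}, PV spl K = some P →
      ∀ r ∈ P, ∀ r' ∈ P, r ≠ r' → SplitPair Ψ r r' := by
  intro K
  induction K with
  | nil =>
    intro P h r hr r' hr' hne
    rw [PV_nil] at h
    obtain rfl := Option.some.inj h
    simp only [List.mem_cons, List.not_mem_nil, or_false] at hr hr'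
    exact absurd (hr.trans hr'.symm) hne
  | cons k K ih =>
    intro Q h u hu v hv hne
    obtain ⟨P, hP, hk, rfl⟩ := PV_cons.1 h
    rw [List.mem_flatMap] at hu hv
    obtain ⟨r, hr, hu⟩ := hu
    obtain ⟨r', hr', hv⟩ := hv
    by_cases hrr : r = r'
    · subst hrr
      have hs : SplitPair Ψ (tok k).2.1 (tok k).2.2.1 :=
        hsp (tok k).2.1 (tok k).2.2.1 (tok k).2.2.2 hk.2.2.2.2.2.1
      by_cases ho : (tok k).1 = r
      · rw [clo_own ho] at hu hv
        simp only [List.mem_cons, List.not_mem_nil, or_false] at hu hv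
        rcases hu with rfl | rfl <;> rcases hv with rfl | rfl
        · exact absurd rfl hne
        · exact hs.mono (List.prefix_append _ _) (List.prefix_append _ _)
        · exact hs.symm.mono (List.prefix_append _ _) (List.prefix_append _ _)
        · exact absurd rfl hne
      · rw [clo_other ho] at hu hv
        simp only [List.mem_cons, List.not_mem_nil, or_false] at hu hv
        exact absurd (hu.trans hv.symm) hne
    · exact (ih hP r hr r' hr' hrr).mono (clo_ext hk hu).1 (clo_ext hk hv).1

theorem compat_of_extends {A : ℕ → Bool} {u v : List Bool} (hu : extendsStr A u)
    (hv : extendsStr A v) : u <+: v ∨ v <+: u := by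
  rcases le_total u.length v.length with h | h
  · exact Or.inl (hv.prefix hu h)
  · exact Or.inr (hu.prefix hv h)

theorem PV_unique (hsp : ∀ x y w, spl (x, y, w) → SplitPair Ψ x y) {A : ℕ → Bool}
    {K : List ℕ} {P : List (List Bool)} (hK : PV spl K = some P) {r r' : List Bool} (hr : r ∈ P)
    (hr' : r' ∈ P) (hA : extendsStr A r) (hA' : extendsStr A r') : r = r' := by
  by_contra hne
  have h1 := PV_split hsp hK r hr r' hr' hne
  rcases compat_of_extends hA hA' with h | h
  · exact h1.not_prefix h
  · exact h1.symm.not_prefix h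

theorem tok_unique (hsp : ∀ x y w, spl (x, y, w) → SplitPair Ψ x y) {A : ℕ → Bool}
    {K : List ℕ} {P : List (List Bool)} (hK : PV spl K = some P) {k m : ℕ}
    (hk : acc spl P k) (hm : acc spl P m) {r r' u v : List Bool} (hr : r ∈ P) (hr' : r' ∈ P)
    (hu : u ∈ clo r k) (hv : v ∈ clo r' m) (hA : extendsStr A u) (hA' : extendsStr A v) :
    k = m := by
  have : r = r' := PV_unique hsp hK hr hr' (hA.mono (clo_ext hk hu).1) (hA'.mono (clo_ext hm hv).1)
  subst this
  rcases lt_trichotomy k m with h | h | h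
  · have := hm.2.2.2.2.2.2 k (mem_accList.2 ⟨h, hk⟩) r hr v hv u hu
    rcases compat_of_extends hA hA' with h | h
    · exact absurd h this.2
    · exact absurd h this.1
  · exact h
  · have := hk.2.2.2.2.2.2 m (mem_accList.2 ⟨h, hm⟩) r hr u hu v hv
    rcases compat_of_extends hA hA' with h | h
    · exact absurd h this.1
    · exact absurd h this.2

theorem seq_unique (hsp : ∀ x y w, spl (x, y, w) → SplitPair Ψ x y) {A : ℕ → Bool} :
    ∀ {K K' : List ℕ} {P P' : List (List Bool)}, PV spl K = some P → PV spl K' = some P' →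
      K.length = K'.length → ∀ {u v : List Bool}, u ∈ P → v ∈ P' → extendsStr A u →
        extendsStr A v → K = K' := by
  intro K
  induction K with
  | nil =>
    intro K' P P' _ _ hl u v _ _ _ _
    exact (List.length_eq_zero_iff.1 hl.symm).symm
  | cons k K ih =>
    intro K' Q Q' hQ hQ' hl u v hu hv hA hA'
    match K', hl with
    | m :: K', hl =>
      obtain ⟨P, hP, hk, rfl⟩ := PV_cons.1 hQ
      obtain ⟨P', hP', hm, rfl⟩ := PV_cons.1 hQ'
      rw [List.mem_flatMap] at hu hv
      obtain ⟨r, hr, hu⟩ := hu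
      obtain ⟨r', hr', hv⟩ := hv
      have : K = K' := ih hP hP' (by simpa using hl) hr hr' (hA.mono (clo_ext hk hu).1)
        (hA'.mono (clo_ext hm hv).1)
      subst this
      have : P = P' := Option.some.inj (hP.symm.trans hP')
      subst this
      rw [tok_unique hsp hP hk hm hr hr' hu hv hA hA']

/-- Every member of a partition has an extension in any later partition. -/
theorem PV_ext_up {K : List ℕ} {P : List (List Bool)} (hK : PV spl K = some P) {r : List Bool}
    (hr : r ∈ P) : ∀ (J : List ℕ) {Q : List (List Bool)}, PV spl (J ++ K) = some Q →
      ∃ u ∈ Q, r <+: u := by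
  intro J
  induction J with
  | nil =>
    intro Q hQ
    have : P = Q := Option.some.inj (hK.symm.trans hQ)
    subst this
    exact ⟨r, hr, List.prefix_rfl⟩
  | cons j J ih =>
    intro Q hQ
    obtain ⟨P', hP', hj, rfl⟩ := PV_cons.1 hQ
    obtain ⟨u, hu, hru⟩ := ih hP'
    obtain ⟨v, hv⟩ := clo_nonempty u j
    exact ⟨v, List.mem_flatMap.2 ⟨u, hu, hv⟩, hru.trans (clo_ext hj hv).1⟩

/-- Every member of a partition extends a member of any earlier partition. -/
theorem PV_ext_down : ∀ (J : List ℕ) {K : List ℕ} {Q : List (List Bool)},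
    PV spl (J ++ K) = some Q → ∀ {u : List Bool}, u ∈ Q →
      ∃ P, PV spl K = some P ∧ ∃ r ∈ P, r <+: u := by
  intro J
  induction J with
  | nil =>
    intro K Q hQ u hu
    exact ⟨Q, hQ, u, hu, List.prefix_rfl⟩
  | cons j J ih =>
    intro K Q hQ u hu
    obtain ⟨P', hP', hj, rfl⟩ := PV_cons.1 hQ
    obtain ⟨v, hv, huv⟩ := List.mem_flatMap.1 hu
    obtain ⟨P, hP, r, hr, hrv⟩ := ih hP' hv
    exact ⟨P, hP, r, hr, hrv.trans (clo_ext hj huv).1⟩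

end Comb

/-! ### Use of genericity -/

/-- If `Ψ^A` is not computable, there are `Ψ`-splittings above every initial segment of `A`. -/
theorem exists_split {A B : ℕ → Bool} {Ψ : OracleCode} (hΨ : Ψ.eval (chi A) = chi B)
    (hB : ¬ ComputableSeq B) {τ : List Bool} (hτ : extendsStr A τ) :
    ∃ x0 x1, τ <+: x0 ∧ τ <+: x1 ∧ SplitPair Ψ x0 x1 := by
  by_contra hcon
  push Not at hcon
  apply hB
  have hex : ∀ i, ∃ σ, τ <+: σ ∧ cond (B i) 1 0 ∈ Ψ.eval (strOracle σ) i := by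
    intro i
    have h1 : cond (B i) 1 0 ∈ Ψ.eval (chi A) i := by rw [hΨ]; simp [chi]
    obtain ⟨m, hm⟩ := eval_cont Ψ A i _ h1
    refine ⟨res A (max m τ.length), ?_, eval_res_mono Ψ A (le_max_left _ _) hm⟩
    exact (extendsStr_res A _).prefix hτ (by simp)
  refine tred_of_sig _ B (fun q => ∃ σ, τ <+: σ ∧ cond q.2.2 1 0 ∈ Ψ.eval (strOracle σ) q.2.1)
    ?_ (fun i => ⟨0, hex i⟩) ?_
  · refine Sig.ex (R := fun (q : List Bool × ℕ × Bool) (σ : List Bool) =>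
      τ <+: σ ∧ cond q.2.2 1 0 ∈ Ψ.eval (strOracle σ) q.2.1) ?_
    refine (Sig.of_prim (pp_prefix (Primrec.const τ) Primrec.snd)).and ?_
    exact (sig_eval Ψ).comp (Primrec.snd.pair ((Primrec.fst.comp (Primrec.snd.comp
      Primrec.fst)).pair (Primrec.cond (Primrec.snd.comp (Primrec.snd.comp Primrec.fst))
        (Primrec.const 1) (Primrec.const 0))))
  · rintro i m v ⟨σ, hσ, hv⟩
    obtain ⟨σ', hσ', hv'⟩ := hex i
    by_contra hne
    refine hcon σ σ' hσ hσ' ⟨i, _, _, hv, hv', ?_⟩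
    simp only at hne ⊢
    revert hne
    cases v <;> cases B i <;> simp

/-- The hypotheses under which the construction is run. -/
structure Setup (A : ℕ → Bool) (Ψ : OracleCode) (spl : List Bool × List Bool × ℕ → Prop) :
    Prop where
  gen : OneGeneric A
  prim : PrimrecPred spl
  sound : ∀ x y w, spl (x, y, w) → SplitPair Ψ x y
  complete : ∀ x y, SplitPair Ψ x y → ∃ w0, ∀ w, w0 ≤ w → spl (x, y, w)
  split : ∀ τ, extendsStr A τ → ∃ x0 x1, τ <+: x0 ∧ τ <+: x1 ∧ SplitPair Ψ x0 x1

theorem exists_setup {A B : ℕ → Bool} {Ψ : OracleCode} (hA : OneGeneric A)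
    (hΨ : Ψ.eval (chi A) = chi B) (hB : ¬ ComputableSeq B) : ∃ spl, Setup A Ψ spl := by
  have h : Sig fun p : List Bool × List Bool => SplitPair Ψ p.1 p.2 := by
    refine Sig.ex (R := fun (p : List Bool × List Bool) (n : ℕ) => ∃ (v₀ v₁ : ℕ),
      v₀ ∈ Ψ.eval (strOracle p.1) n ∧ v₁ ∈ Ψ.eval (strOracle p.2) n ∧ v₀ ≠ v₁) ?_
    refine Sig.ex (R := fun (p : (List Bool × List Bool) × ℕ) (v₀ : ℕ) => ∃ (v₁ : ℕ),
      v₀ ∈ Ψ.eval (strOracle p.1.1) p.2 ∧ v₁ ∈ Ψ.eval (strOracle p.1.2) p.2 ∧ v₀ ≠ v₁) ?_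
    refine Sig.ex (R := fun (p : ((List Bool × List Bool) × ℕ) × ℕ) (v₁ : ℕ) =>
      p.2 ∈ Ψ.eval (strOracle p.1.1.1) p.1.2 ∧ v₁ ∈ Ψ.eval (strOracle p.1.1.2) p.1.2 ∧
        p.2 ≠ v₁) ?_
    have e1 : Primrec fun p : (((List Bool × List Bool) × ℕ) × ℕ) × ℕ => p.1.1 :=
      Primrec.fst.comp Primrec.fst
    refine ((sig_eval Ψ).comp (Primrec.pair (Primrec.fst.comp (Primrec.fst.comp e1))
      (Primrec.pair (Primrec.snd.comp e1) (Primrec.snd.comp Primrec.fst)))).and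
      (((sig_eval Ψ).comp (Primrec.pair (Primrec.snd.comp (Primrec.fst.comp e1))
      (Primrec.pair (Primrec.snd.comp e1) Primrec.snd))).and (Sig.of_prim ?_))
    exact (Primrec.eq.comp (Primrec.snd.comp Primrec.fst) Primrec.snd).not
  obtain ⟨D, hD, hm, hd⟩ := h.mono
  refine ⟨fun q => D ((q.1, q.2.1), q.2.2), hA, ?_, ?_, ?_, fun τ hτ => exists_split hΨ hB hτ⟩
  · exact hD.comp ((Primrec.fst.pair (Primrec.fst.comp Primrec.snd)).pair
      (Primrec.snd.comp Primrec.snd))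
  · intro x y w hw
    exact (hd (x, y)).2 ⟨w, hw⟩
  · intro x y hxy
    obtain ⟨w, hw⟩ := (hd (x, y)).1 hxy
    exact ⟨w, fun w' h => hm _ _ _ h hw⟩

theorem not_prefix_of_getElem? {u v : List Bool} {i : ℕ} {a b : Bool} (hu : u[i]? = some a)
    (hv : v[i]? = some b) (hab : a ≠ b) : ¬ u <+: v ∧ ¬ v <+: u := by
  constructor
  · rintro ⟨t, rfl⟩
    grind
  · rintro ⟨t, rfl⟩
    grind

theorem pad_lt {k j : ℕ} (h : j < k) : (pad k)[j]? = some false := by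
  rw [pad_eq]; grind

theorem pad_self (k : ℕ) : (pad k)[k]? = some true := by
  rw [pad_eq]; grind

section Gen

variable {A : ℕ → Bool} {Ψ : OracleCode} {spl : List Bool × List Bool × ℕ → Prop}

theorem next_tok (S : Setup A Ψ spl) {P : List (List Bool)} {p : List Bool} (hp : p ∈ P)
    (hA : extendsStr A p) : ∃ k, acc spl P k ∧ ∃ u ∈ clo p k, extendsStr A u := by
  have hW : CE {σ | ∃ k, acc spl P k ∧ ∃ u ∈ clo p k, u <+: σ} := by
    refine Sig.ce (Sig.ex (R := fun (σ : List Bool) (k : ℕ) =>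
      acc spl P k ∧ ∃ u ∈ clo p k, u <+: σ) (Sig.of_prim ?_))
    refine ((pp_acc S.prim).comp ((Primrec.const P).pair Primrec.snd)).and ?_
    exact pp_ex_mem (R := fun (q : List Bool × ℕ) u => u <+: q.1)
      (pp_prefix Primrec.snd (Primrec.fst.comp Primrec.fst))
      (prim_clo.comp (Primrec.const p) Primrec.snd)
  obtain ⟨σ, hσ, h | h⟩ := S.gen _ hW
  · obtain ⟨k, hk, u, hu, hus⟩ := h
    exact ⟨k, hk, u, hu, hσ.mono hus⟩
  exfalso
  obtain ⟨τ, hτ, hστ, hpτ⟩ : ∃ τ, extendsStr A τ ∧ σ <+: τ ∧ p <+: τ := by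
    rcases compat_of_extends hσ hA with h | h
    · exact ⟨p, hA, h, List.prefix_rfl⟩
    · exact ⟨σ, hσ, List.prefix_rfl, h⟩
  obtain ⟨x0, x1, h0, h1, hs⟩ := S.split τ hτ
  obtain ⟨w0, hw0⟩ := S.complete x0 x1 hs
  obtain ⟨k, hk, htk⟩ := tok_surj p x0 x1 (w0 + x0.length + x1.length)
  have hcl : clo p k = [x0 ++ true :: pad k, x1 ++ true :: pad k] := by
    rw [clo_own (by rw [htk]), htk]
  have hbig : ∀ u ∈ clo p k, σ <+: u := by
    intro u hu
    rw [hcl] at hu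
    simp only [List.mem_cons, List.not_mem_nil, or_false] at hu
    rcases hu with rfl | rfl
    · exact hστ.trans (h0.trans (List.prefix_append _ _))
    · exact hστ.trans (h1.trans (List.prefix_append _ _))
  have hacc : acc spl P k := by
    refine ⟨by rw [htk]; exact hp, by rw [htk]; exact hpτ.trans h0, by rw [htk]; exact hpτ.trans h1,
      by rw [htk]; simp only; omega, by rw [htk]; simp only; omega,
      by rw [htk]; exact hw0 _ (by omega), ?_⟩
    intro m hm r hr u hu v hv
    obtain ⟨hmk, hm⟩ := mem_accList.1 hm
    by_cases hrp : p = r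
    · subst hrp
      constructor
      · intro huv
        exact h v ((hbig u hu).trans huv) ⟨m, hm, v, hv, List.prefix_rfl⟩
      · intro hvu
        exact h u (hbig u hu) ⟨m, hm, v, hv, hvu⟩
    · rw [clo_other (by rw [htk]; exact hrp)] at hu
      simp only [List.mem_cons, List.not_mem_nil, or_false] at hu
      subst hu
      by_cases ho : (tok m).1 = r
      · rw [clo_own ho] at hv
        have key : ∀ x : List Bool, r <+: x → x.length ≤ m →
            ¬ (r ++ false :: pad k) <+: (x ++ true :: pad m) ∧
            ¬ (x ++ true :: pad m) <+: (r ++ false :: pad k) := by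
          rintro x hx hl
          have hrl := hx.length_le
          refine not_prefix_of_getElem? (i := x.length) (a := false) (b := true) ?_ ?_ (by simp)
          · rw [List.getElem?_append_right hrl]
            rcases Nat.eq_zero_or_pos (x.length - r.length) with h | h
            · rw [h]; rfl
            · obtain ⟨j, hj⟩ := Nat.exists_eq_succ_of_ne_zero h.ne'
              rw [hj, Nat.succ_eq_add_one, List.getElem?_cons_succ]
              exact pad_lt (by omega)
          · rw [List.getElem?_append_right le_rfl]; simp
        have e1 := hm.2.1
        have e2 := hm.2.2.1
        rw [ho] at e1 e2
        simp only [List.mem_cons, List.not_mem_nil, or_false] at hv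
        rcases hv with rfl | rfl
        · exact key _ e1 hm.2.2.2.1
        · exact key _ e2 hm.2.2.2.2.1
      · rw [clo_other ho] at hv
        simp only [List.mem_cons, List.not_mem_nil, or_false] at hv
        subst hv
        refine not_prefix_of_getElem? (i := r.length + (m + 1)) (a := false) (b := true) ?_ ?_
          (by simp)
        · rw [List.getElem?_append_right (by omega), Nat.add_sub_cancel_left,
            List.getElem?_cons_succ]
          exact pad_lt hmk
        · rw [List.getElem?_append_right (by omega), Nat.add_sub_cancel_left,
            List.getElem?_cons_succ]
          exact pad_self m
  exact h (x0 ++ true :: pad k) (hbig _ (by rw [hcl]; simp))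
    ⟨k, hacc, _, by rw [hcl]; exact List.mem_cons_self, List.prefix_rfl⟩

/-- `p` belongs to the partition determined by the tokens `K`. -/
def Val (spl : List Bool × List Bool × ℕ → Prop) (K : List ℕ) (p : List Bool) : Prop :=
  ∃ P, PV spl K = some P ∧ p ∈ P

theorem sig_val (hs : PrimrecPred spl) :
    Sig fun q : List ℕ × List Bool => Val spl q.1 q.2 := by
  refine Sig.ex (R := fun (q : List ℕ × List Bool) (P : List (List Bool)) =>
    PV spl q.1 = some P ∧ q.2 ∈ P) (Sig.of_prim (PrimrecPred.and ?_ ?_))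
  · exact Primrec.eq.comp ((prim_PV hs).comp (Primrec.fst.comp Primrec.fst))
      (Primrec.option_some.comp Primrec.snd)
  · exact pp_mem (Primrec.snd.comp Primrec.fst) Primrec.snd

/-- `K` is a sequence of tokens along `A`, with `p` the corresponding initial segment of `A`. -/
def On (spl : List Bool × List Bool × ℕ → Prop) (A : ℕ → Bool) (K : List ℕ) (p : List Bool) :
    Prop :=
  Val spl K p ∧ extendsStr A p

theorem on_cons {K : List ℕ} {P : List (List Bool)} {p u : List Bool} {k : ℕ}
    (hK : PV spl K = some P) (hp : p ∈ P) (hk : acc spl P k) (hu : u ∈ clo p k) :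
    Val spl (k :: K) u :=
  ⟨_, PV_cons.2 ⟨P, hK, hk, rfl⟩, List.mem_flatMap.2 ⟨p, hp, hu⟩⟩

theorem exists_on (S : Setup A Ψ spl) (s : ℕ) :
    ∃ K p, On spl A K p ∧ K.length = s ∧ s ≤ p.length := by
  induction s with
  | zero => exact ⟨[], [], ⟨⟨[[]], PV_nil, by simp⟩, fun i => i.elim0⟩, rfl, by simp⟩
  | succ s ih =>
    obtain ⟨K, p, ⟨⟨P, hK, hp⟩, hA⟩, hl, hs⟩ := ih
    obtain ⟨k, hk, u, hu, hAu⟩ := next_tok S hp hA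
    have := (clo_ext hk hu).2
    exact ⟨k :: K, u, ⟨on_cons hK hp hk hu, hAu⟩, by simp [hl], by omega⟩

theorem On.down {J K : List ℕ} {u : List Bool} (h : On spl A (J ++ K) u) :
    ∃ r, On spl A K r ∧ r <+: u := by
  obtain ⟨⟨Q, hQ, hu⟩, hA⟩ := h
  obtain ⟨P, hP, r, hr, hru⟩ := PV_ext_down J hQ hu
  exact ⟨r, ⟨⟨P, hP, hr⟩, hA.mono hru⟩, hru⟩

theorem On.comp (S : Setup A Ψ spl) {K K' : List ℕ} {p p' : List Bool} (h : On spl A K p)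
    (h' : On spl A K' p') (hl : K.length ≤ K'.length) : ∃ J, K' = J ++ K := by
  have e := List.take_append_drop (K'.length - K.length) K'
  refine ⟨K'.take (K'.length - K.length), ?_⟩
  have h2 := h'
  rw [← e] at h2
  obtain ⟨r, ⟨⟨P, hP, hr⟩, hAr⟩, -⟩ := h2.down
  obtain ⟨⟨Q, hQ, hp⟩, hA⟩ := h
  have : K = K'.drop (K'.length - K.length) :=
    seq_unique S.sound hQ hP (by simp; omega) hp hr hA hAr
  conv_rhs => rw [this]
  conv_lhs => rw [← e]
  rw [← this]

theorem On.unique (S : Setup A Ψ spl) {K : List ℕ} {p p' : List Bool} (h : On spl A K p)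
    (h' : On spl A K p') : p = p' := by
  obtain ⟨⟨P, hP, hp⟩, hA⟩ := h
  obtain ⟨⟨Q, hQ, hp'⟩, hA'⟩ := h'
  have : P = Q := Option.some.inj (hP.symm.trans hQ)
  subst this
  exact PV_unique S.sound hP hp hp' hA hA'

theorem On.agree (S : Setup A Ψ spl) {K K' : List ℕ} {p p' : List Bool} (h : On spl A K p)
    (h' : On spl A K' p') {i k : ℕ} (hi : i < K.length) (hk : K'.reverse[i]? = some k) :
    K.reverse[i]? = some k := by
  rcases le_total K.length K'.length with hl | hl
  · obtain ⟨J, rfl⟩ := h.comp S h' hl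
    rw [List.reverse_append, List.getElem?_append_left (by simpa using hi)] at hk
    exact hk
  · obtain ⟨J, rfl⟩ := h'.comp S h hl
    have : i < K'.reverse.length := by
      by_contra hc
      rw [List.getElem?_eq_none (by omega)] at hk
      simp at hk
    rw [List.reverse_append, List.getElem?_append_left this]
    exact hk

/-- Arbitrarily long members of the partitions are followed by `true` along `A`. -/
theorem exists_on_true (S : Setup A Ψ spl) (n : ℕ) :
    ∃ K p, On spl A K p ∧ n ≤ p.length ∧ extendsStr A (p ++ [true]) := by
  have hW : CE {σ | ∃ K p, Val spl K p ∧ n ≤ p.length ∧ (p ++ [true]) <+: σ} := by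
    refine Sig.ce (Sig.ex (R := fun (σ : List Bool) (K : List ℕ) =>
      ∃ p, Val spl K p ∧ n ≤ p.length ∧ (p ++ [true]) <+: σ) ?_)
    refine Sig.ex (R := fun (q : List Bool × List ℕ) (p : List Bool) =>
      Val spl q.2 p ∧ n ≤ p.length ∧ (p ++ [true]) <+: q.1) ?_
    refine ((sig_val S.prim).comp ((Primrec.snd.comp Primrec.fst).pair Primrec.snd)).and
      (Sig.of_prim (PrimrecPred.and ?_ ?_))
    · exact Primrec.nat_le.comp (Primrec.const n) (Primrec.list_length.comp Primrec.snd)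
    · exact pp_prefix (Primrec.list_append.comp Primrec.snd (Primrec.const [true]))
        (Primrec.fst.comp Primrec.fst)
  obtain ⟨σ, hσ, h | h⟩ := S.gen _ hW
  · obtain ⟨K, p, hv, hn, hp⟩ := h
    exact ⟨K, p, ⟨hv, hσ.mono ((List.prefix_append _ _).trans hp)⟩, hn, hσ.mono hp⟩
  · exfalso
    obtain ⟨K, p, hon, -, hl⟩ := exists_on S (n + σ.length)
    have h1 : σ <+: p := hon.2.prefix hσ (by omega)
    exact h (p ++ [true]) (h1.trans (List.prefix_append _ _))
      ⟨K, p, hon.1, by omega, List.prefix_rfl⟩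

end Gen

/-! ### The complement -/

/-- The finite string describing a sequence of tokens. -/
def cstr (K : List ℕ) : List Bool :=
  (List.range K.length).map fun n => decide (K.reverse[n.unpair.1]? = some n.unpair.2)

theorem prim_graph : Primrec fun q : List ℕ × ℕ =>
    decide (q.1.reverse[q.2.unpair.1]? = some q.2.unpair.2) :=
  PrimrecPred.decide (Primrec.eq.comp (Primrec.list_getElem?.comp
    (Primrec.list_reverse.comp Primrec.fst) (Primrec.fst.comp (Primrec.unpair.comp Primrec.snd)))
    (Primrec.option_some.comp (Primrec.snd.comp (Primrec.unpair.comp Primrec.snd))))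

theorem prim_cstr : Primrec cstr :=
  Primrec.list_map (Primrec.list_range.comp Primrec.list_length) prim_graph.to₂

@[simp] theorem cstr_length (K : List ℕ) : (cstr K).length = K.length := by simp [cstr]

open Classical in
/-- The graph of the sequence of tokens along `A`. -/
noncomputable def tokSeq (spl : List Bool × List Bool × ℕ → Prop) (A : ℕ → Bool) : ℕ → Bool :=
  fun n => decide (∃ K p, On spl A K p ∧ K.reverse[n.unpair.1]? = some n.unpair.2)

theorem tred_join {A B C : ℕ → Bool} (hB : TRed B A) (hC : TRed C A) : TRed (join B C) A := by
  obtain ⟨b, hb⟩ := hB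
  obtain ⟨c, hc⟩ := hC
  have hgraph : ∀ {c : OracleCode} {Z : ℕ → Bool}, c.eval (chi A) = chi Z → ∀ i,
      (∃ m, cond (Z i) 1 0 ∈ c.eval (strOracle (res A m)) i) ∧
      ∀ m v, cond v 1 0 ∈ c.eval (strOracle (res A m)) i → v = Z i := by
    intro c Z h i
    constructor
    · exact eval_cont c A i _ (by rw [h]; simp [chi])
    · intro m v hv
      have := eval_str_chi c (extendsStr_res A m) hv
      rw [h] at this
      simp only [chi, Part.mem_some_iff] at this
      revert this
      cases v <;> cases Z i <;> simp
  refine tred_of_sig A (join B C) (fun q =>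
    (q.2.1 % 2 = 0 ∧ cond q.2.2 1 0 ∈ b.eval (strOracle q.1) (q.2.1 / 2)) ∨
    (q.2.1 % 2 ≠ 0 ∧ cond q.2.2 1 0 ∈ c.eval (strOracle q.1) (q.2.1 / 2))) ?_ ?_ ?_
  · have hi : Primrec fun q : List Bool × ℕ × Bool => q.2.1 := Primrec.fst.comp Primrec.snd
    have hm : PrimrecPred fun q : List Bool × ℕ × Bool => q.2.1 % 2 = 0 :=
      Primrec.eq.comp (Primrec.nat_mod.comp hi (Primrec.const 2)) (Primrec.const 0)
    have he : Primrec fun q : List Bool × ℕ × Bool => (q.1, q.2.1 / 2, cond q.2.2 1 0) :=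
      Primrec.fst.pair ((Primrec.nat_div.comp hi (Primrec.const 2)).pair
        (Primrec.cond (Primrec.snd.comp Primrec.snd) (Primrec.const 1) (Primrec.const 0)))
    exact ((Sig.of_prim hm).and ((sig_eval b).comp he)).or
      ((Sig.of_prim hm.not).and ((sig_eval c).comp he))
  · intro i
    by_cases h : i % 2 = 0
    · obtain ⟨m, hm⟩ := (hgraph hb (i / 2)).1
      exact ⟨m, Or.inl ⟨h, by simpa [join, h] using hm⟩⟩
    · obtain ⟨m, hm⟩ := (hgraph hc (i / 2)).1
      exact ⟨m, Or.inr ⟨h, by simpa [join, h] using hm⟩⟩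
  · rintro i m v (⟨h, hv⟩ | ⟨h, hv⟩)
    · have := (hgraph hb (i / 2)).2 m v hv
      simpa [join, h] using this
    · have := (hgraph hc (i / 2)).2 m v hv
      simpa [join, h] using this

theorem list_bound {P : List (List Bool)} {Q : List Bool → ℕ → Prop}
    (h : ∀ r ∈ P, ∃ m, ∀ m', m ≤ m' → Q r m') : ∃ m, ∀ r ∈ P, ∀ m', m ≤ m' → Q r m' := by
  induction P with
  | nil => exact ⟨0, by simp⟩
  | cons x P ih =>
    obtain ⟨m, hm⟩ := ih fun r hr => h r (by simp [hr])
    obtain ⟨n, hn⟩ := h x (by simp)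
    refine ⟨max m n, fun r hr m' hm' => ?_⟩
    rcases List.mem_cons.1 hr with rfl | hr
    · exact hn m' ((le_max_right _ _).trans hm')
    · exact hm r hr m' ((le_max_left _ _).trans hm')

theorem nat_bound (f : ℕ → ℕ) (n : ℕ) : ∃ m, ∀ s < n, f s < m := by
  induction n with
  | zero => exact ⟨0, by simp⟩
  | succ n ih =>
    obtain ⟨m, hm⟩ := ih
    refine ⟨max m (f n + 1), fun s hs => ?_⟩
    rcases Nat.lt_succ_iff_lt_or_eq.1 hs with h | rfl
    · exact (hm s h).trans_le (le_max_left _ _)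
    · exact lt_of_lt_of_le (Nat.lt_succ_self _) (le_max_right _ _)

section Main

variable {A B : ℕ → Bool} {Ψ : OracleCode} {spl : List Bool × List Bool × ℕ → Prop}

theorem tokSeq_eq (S : Setup A Ψ spl) {K : List ℕ} {p : List Bool} (h : On spl A K p) {n : ℕ}
    (hn : n < K.length) :
    tokSeq spl A n = decide (K.reverse[n.unpair.1]? = some n.unpair.2) := by
  classical
  unfold tokSeq
  rw [decide_eq_decide]
  constructor
  · rintro ⟨K', p', h', hk⟩
    exact h.agree S h' ((Nat.unpair_left_le n).trans_lt hn) hk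
  · intro hk
    exact ⟨K, p, h, hk⟩

theorem cstr_ext (S : Setup A Ψ spl) {K : List ℕ} {p : List Bool} (h : On spl A K p) :
    extendsStr (tokSeq spl A) (cstr K) := by
  rintro ⟨i, hi⟩
  rw [cstr_length] at hi
  rw [tokSeq_eq S h hi]
  simp [cstr]

theorem tokSeq_le (S : Setup A Ψ spl) : TRed (tokSeq spl A) A := by
  refine tred_of_sig A _ (fun q => ∃ K p, Val spl K p ∧ p <+: q.1 ∧ q.2.1 < K.length ∧
    q.2.2 = decide (K.reverse[q.2.1.unpair.1]? = some q.2.1.unpair.2)) ?_ ?_ ?_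
  · refine Sig.ex (R := fun (q : List Bool × ℕ × Bool) (K : List ℕ) => ∃ p, Val spl K p ∧
      p <+: q.1 ∧ q.2.1 < K.length ∧
      q.2.2 = decide (K.reverse[q.2.1.unpair.1]? = some q.2.1.unpair.2)) ?_
    refine Sig.ex (R := fun (q : (List Bool × ℕ × Bool) × List ℕ) (p : List Bool) =>
      Val spl q.2 p ∧ p <+: q.1.1 ∧ q.1.2.1 < q.2.length ∧
      q.1.2.2 = decide (q.2.reverse[q.1.2.1.unpair.1]? = some q.1.2.1.unpair.2)) ?_
    have eK : Primrec fun q : ((List Bool × ℕ × Bool) × List ℕ) × List Bool => q.1.2 :=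
      Primrec.snd.comp Primrec.fst
    have e1 : Primrec fun q : ((List Bool × ℕ × Bool) × List ℕ) × List Bool => q.1.1 :=
      Primrec.fst.comp Primrec.fst
    have ei := Primrec.fst.comp (Primrec.snd.comp e1)
    have ev := Primrec.snd.comp (Primrec.snd.comp e1)
    refine ((sig_val S.prim).comp (eK.pair Primrec.snd)).and
      (Sig.of_prim (PrimrecPred.and ?_ (PrimrecPred.and ?_ ?_)))
    · exact pp_prefix Primrec.snd (Primrec.fst.comp e1)
    · exact Primrec.nat_lt.comp ei (Primrec.list_length.comp eK)
    · exact Primrec.eq.comp ev (prim_graph.comp (eK.pair ei))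
  · intro n
    obtain ⟨K, p, h, hl, -⟩ := exists_on S (n + 1)
    refine ⟨p.length, K, p, h.1, ?_, by simp only; omega, tokSeq_eq S h (by omega)⟩
    rw [(extendsStr_iff A p).1 h.2]
  · rintro n m v ⟨K, p, hv, hp, hn, h⟩
    simp only at hp hn h
    rw [h, tokSeq_eq S ⟨hv, (extendsStr_res A m).mono hp⟩ hn]

theorem not_le_tokSeq (S : Setup A Ψ spl) : ¬ TRed A (tokSeq spl A) := by
  rintro ⟨Θ, hΘ⟩
  have hW : CE {σ | ∃ K p, Val spl K p ∧ p <+: σ ∧ ∃ i v b,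
      v ∈ Θ.eval (strOracle (cstr K)) i ∧ σ[i]? = some b ∧ v ≠ cond b 1 0} := by
    refine Sig.ce (Sig.ex (R := fun (σ : List Bool) (K : List ℕ) =>
      ∃ p, Val spl K p ∧ p <+: σ ∧ ∃ i v b,
      v ∈ Θ.eval (strOracle (cstr K)) i ∧ σ[i]? = some b ∧ v ≠ cond b 1 0) ?_)
    refine Sig.ex (R := fun (q : List Bool × List ℕ) (p : List Bool) =>
      Val spl q.2 p ∧ p <+: q.1 ∧ ∃ i v b,
      v ∈ Θ.eval (strOracle (cstr q.2)) i ∧ q.1[i]? = some b ∧ v ≠ cond b 1 0) ?_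
    refine ((sig_val S.prim).comp ((Primrec.snd.comp Primrec.fst).pair Primrec.snd)).and
      ((Sig.of_prim (pp_prefix Primrec.snd (Primrec.fst.comp Primrec.fst))).and ?_)
    refine Sig.comp (R := fun q : List Bool × List ℕ => ∃ i v b,
      v ∈ Θ.eval (strOracle (cstr q.2)) i ∧ q.1[i]? = some b ∧ v ≠ cond b 1 0) ?_ Primrec.fst
    refine Sig.ex (R := fun (q : List Bool × List ℕ) (i : ℕ) => ∃ v b,
      v ∈ Θ.eval (strOracle (cstr q.2)) i ∧ q.1[i]? = some b ∧ v ≠ cond b 1 0) ?_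
    refine Sig.ex (R := fun (q : (List Bool × List ℕ) × ℕ) (v : ℕ) => ∃ b,
      v ∈ Θ.eval (strOracle (cstr q.1.2)) q.2 ∧ q.1.1[q.2]? = some b ∧ v ≠ cond b 1 0) ?_
    refine Sig.ex (R := fun (q : ((List Bool × List ℕ) × ℕ) × ℕ) (b : Bool) =>
      q.2 ∈ Θ.eval (strOracle (cstr q.1.1.2)) q.1.2 ∧ q.1.1.1[q.1.2]? = some b ∧
        q.2 ≠ cond b 1 0) ?_
    have e1 : Primrec fun q : (((List Bool × List ℕ) × ℕ) × ℕ) × Bool => q.1.1.1 :=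
      Primrec.fst.comp (Primrec.fst.comp Primrec.fst)
    have ei : Primrec fun q : (((List Bool × List ℕ) × ℕ) × ℕ) × Bool => q.1.1.2 :=
      Primrec.snd.comp (Primrec.fst.comp Primrec.fst)
    have ev : Primrec fun q : (((List Bool × List ℕ) × ℕ) × ℕ) × Bool => q.1.2 :=
      Primrec.snd.comp Primrec.fst
    refine ((sig_eval Θ).comp ((prim_cstr.comp (Primrec.snd.comp e1)).pair (ei.pair ev))).and
      (Sig.of_prim (PrimrecPred.and ?_ ?_))
    · exact Primrec.eq.comp (Primrec.list_getElem?.comp (Primrec.fst.comp e1) ei)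
        (Primrec.option_some.comp Primrec.snd)
    · exact (Primrec.eq.comp ev (Primrec.cond Primrec.snd (Primrec.const 1)
        (Primrec.const 0))).not
  obtain ⟨τ, hτ, h | h⟩ := S.gen _ hW
  · obtain ⟨K, p, hv, hp, i, v, b, he, hb, hne⟩ := h
    have h1 := eval_str_chi Θ (cstr_ext S ⟨hv, hτ.mono hp⟩) he
    rw [hΘ] at h1
    simp only [chi, Part.mem_some_iff] at h1
    rw [hτ.getElem? hb] at h1
    exact hne h1
  · obtain ⟨K, p, ⟨⟨P, hP, hp⟩, hAp⟩, hl, hpt⟩ := exists_on_true S τ.length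
    have hτp : τ <+: p := hAp.prefix hτ hl
    obtain ⟨k, hk, u, hu, hAu⟩ := next_tok S hp hAp
    have hown : (tok k).1 = p := by
      by_contra ho
      rw [clo_other ho] at hu
      simp only [List.mem_cons, List.not_mem_nil, or_false] at hu
      have h1 : A p.length = true := hpt.getElem? (i := p.length) (by simp)
      have h2 : A p.length = false := hAu.getElem? (i := p.length) (by rw [hu]; simp)
      rw [h1] at h2
      exact absurd h2 (by simp)
    obtain ⟨u', hu', hne⟩ : ∃ u' ∈ clo p k, u' ≠ u := by
      have hs := S.sound (tok k).2.1 (tok k).2.2.1 (tok k).2.2.2 hk.2.2.2.2.2.1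
      have hs' : (tok k).2.1 ++ true :: pad k ≠ (tok k).2.2.1 ++ true :: pad k := by
        intro e
        have := hs.mono (List.prefix_append _ (true :: pad k))
          (List.prefix_append _ (true :: pad k))
        rw [e] at this
        exact this.irrefl
      rw [clo_own hown] at hu ⊢
      simp only [List.mem_cons, List.not_mem_nil, or_false] at hu
      rcases hu with rfl | rfl
      · exact ⟨_, by simp, hs'.symm⟩
      · exact ⟨_, List.mem_cons_self, hs'⟩
    have hon : On spl A (k :: K) u := ⟨on_cons hP hp hk hu, hAu⟩
    have hval' : Val spl (k :: K) u' := on_cons hP hp hk hu'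
    have hnA : ¬ extendsStr A u' := fun hA' => hne (On.unique S ⟨hval', hA'⟩ hon)
    unfold extendsStr at hnA
    push Not at hnA
    obtain ⟨i, hi⟩ := hnA
    obtain ⟨m, hm⟩ := eval_cont Θ (tokSeq spl A) i.1 (cond (A i.1) 1 0) (by rw [hΘ]; simp [chi])
    obtain ⟨K', p', hon', hl', -⟩ := exists_on S (m + K.length + 1)
    obtain ⟨J, rfl⟩ := hon.comp S hon' (by simp; omega)
    obtain ⟨Q, hQ, hu'Q⟩ := hval'
    obtain ⟨⟨Q', hQ', -⟩, -⟩ := id hon'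
    obtain ⟨u'', hu'', hpre⟩ := PV_ext_up hQ hu'Q J hQ'
    refine h u'' (hτp.trans ((clo_ext hk hu').1.trans hpre))
      ⟨J ++ k :: K, u'', ⟨Q', hQ', hu''⟩, List.prefix_rfl, i.1, cond (A i.1) 1 0, u'.get i, ?_, ?_, ?_⟩
    · refine eval_str_mono Θ ?_ hm
      exact (cstr_ext S hon').prefix (extendsStr_res _ m) (by simp at hl' ⊢; omega)
    · obtain ⟨t, rfl⟩ := hpre
      rw [List.getElem?_append_left i.2]
      simp
    · revert hi
      cases A i.1 <;> cases u'.get i <;> simp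

theorem le_join (S : Setup A Ψ spl) (hΨ : Ψ.eval (chi A) = chi B) :
    TRed A (join B (tokSeq spl A)) := by
  set C := tokSeq spl A with hC
  have jeven : ∀ n, join B C (2 * n) = B n := by intro n; simp [join]
  have jodd : ∀ n, join B C (2 * n + 1) = C n := by
    intro n
    have h1 : (2 * n + 1) % 2 = 1 := by omega
    have h2 : (2 * n + 1) / 2 = n := by omega
    simp [join, h1, h2]
  refine tred_of_sig _ A (fun q => ∃ K P p, PV spl K = some P ∧ p ∈ P ∧ p[q.2.1]? = some q.2.2 ∧
    (∀ s ∈ List.range K.length, q.1[2 * Nat.pair s (K.reverse.getD s 0) + 1]? = some true) ∧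
    ∀ r ∈ P, r = p ∨ ∃ n x b, x ∈ Ψ.eval (strOracle r) n ∧ q.1[2 * n]? = some b ∧
      x ≠ cond b 1 0) ?_ ?_ ?_
  · refine Sig.ex (R := fun (q : List Bool × ℕ × Bool) (K : List ℕ) => ∃ P p,
      PV spl K = some P ∧ p ∈ P ∧ p[q.2.1]? = some q.2.2 ∧
      (∀ s ∈ List.range K.length, q.1[2 * Nat.pair s (K.reverse.getD s 0) + 1]? = some true) ∧
      ∀ r ∈ P, r = p ∨ ∃ n x b, x ∈ Ψ.eval (strOracle r) n ∧ q.1[2 * n]? = some b ∧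
        x ≠ cond b 1 0) ?_
    refine Sig.ex (R := fun (q : (List Bool × ℕ × Bool) × List ℕ) (P : List (List Bool)) => ∃ p,
      PV spl q.2 = some P ∧ p ∈ P ∧ p[q.1.2.1]? = some q.1.2.2 ∧
      (∀ s ∈ List.range q.2.length,
        q.1.1[2 * Nat.pair s (q.2.reverse.getD s 0) + 1]? = some true) ∧
      ∀ r ∈ P, r = p ∨ ∃ n x b, x ∈ Ψ.eval (strOracle r) n ∧ q.1.1[2 * n]? = some b ∧
        x ≠ cond b 1 0) ?_
    refine Sig.ex (R := fun (q : ((List Bool × ℕ × Bool) × List ℕ) × List (List Bool))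
      (p : List Bool) =>
      PV spl q.1.2 = some q.2 ∧ p ∈ q.2 ∧ p[q.1.1.2.1]? = some q.1.1.2.2 ∧
      (∀ s ∈ List.range q.1.2.length,
        q.1.1.1[2 * Nat.pair s (q.1.2.reverse.getD s 0) + 1]? = some true) ∧
      ∀ r ∈ q.2, r = p ∨ ∃ n x b, x ∈ Ψ.eval (strOracle r) n ∧ q.1.1.1[2 * n]? = some b ∧
        x ≠ cond b 1 0) ?_
    have eP : Primrec fun q : (((List Bool × ℕ × Bool) × List ℕ) × List (List Bool)) × List Bool =>
      q.1.2 := Primrec.snd.comp Primrec.fst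
    have eK : Primrec fun q : (((List Bool × ℕ × Bool) × List ℕ) × List (List Bool)) × List Bool =>
      q.1.1.2 := Primrec.snd.comp (Primrec.fst.comp Primrec.fst)
    have e1 : Primrec fun q : (((List Bool × ℕ × Bool) × List ℕ) × List (List Bool)) × List Bool =>
      q.1.1.1 := Primrec.fst.comp (Primrec.fst.comp Primrec.fst)
    have eρ := Primrec.fst.comp e1
    have ei := Primrec.fst.comp (Primrec.snd.comp e1)
    have ev := Primrec.snd.comp (Primrec.snd.comp e1)
    refine Sig.and (Sig.of_prim (Primrec.eq.comp ((prim_PV S.prim).comp eK)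
      (Primrec.option_some.comp eP))) (Sig.and (Sig.of_prim (pp_mem Primrec.snd eP))
      (Sig.and (Sig.of_prim (Primrec.eq.comp (Primrec.list_getElem?.comp Primrec.snd ei)
      (Primrec.option_some.comp ev))) (Sig.and (Sig.of_prim ?_) ?_)))
    · refine pp_all_mem (R := fun (q : (((List Bool × ℕ × Bool) × List ℕ) × List (List Bool)) ×
        List Bool) (s : ℕ) =>
        q.1.1.1.1[2 * Nat.pair s (q.1.1.2.reverse.getD s 0) + 1]? = some true) ?_
        (Primrec.list_range.comp (Primrec.list_length.comp eK))
      refine Primrec.eq.comp (Primrec.list_getElem?.comp (eρ.comp Primrec.fst)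
        (Primrec.succ.comp (Primrec.nat_mul.comp (Primrec.const 2) (Primrec₂.natPair.comp
          Primrec.snd ((Primrec.list_getD 0).comp (Primrec.list_reverse.comp (eK.comp Primrec.fst))
          Primrec.snd))))) (Primrec.const (some true))
    · refine Sig.all_mem (R := fun (q : (((List Bool × ℕ × Bool) × List ℕ) × List (List Bool)) ×
        List Bool) (r : List Bool) => r = q.2 ∨ ∃ n x b, x ∈ Ψ.eval (strOracle r) n ∧
          q.1.1.1.1[2 * n]? = some b ∧ x ≠ cond b 1 0) ?_ eP
      refine Sig.or (Sig.of_prim (Primrec.eq.comp Primrec.snd (Primrec.snd.comp Primrec.fst))) ?_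
      refine Sig.comp (R := fun q : List Bool × List Bool => ∃ n x b,
        x ∈ Ψ.eval (strOracle q.2) n ∧ q.1[2 * n]? = some b ∧ x ≠ cond b 1 0) ?_
        ((eρ.comp Primrec.fst).pair Primrec.snd)
      refine Sig.ex (R := fun (q : List Bool × List Bool) (n : ℕ) => ∃ x b,
        x ∈ Ψ.eval (strOracle q.2) n ∧ q.1[2 * n]? = some b ∧ x ≠ cond b 1 0) ?_
      refine Sig.ex (R := fun (q : (List Bool × List Bool) × ℕ) (x : ℕ) => ∃ b,
        x ∈ Ψ.eval (strOracle q.1.2) q.2 ∧ q.1.1[2 * q.2]? = some b ∧ x ≠ cond b 1 0) ?_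
      refine Sig.ex (R := fun (q : ((List Bool × List Bool) × ℕ) × ℕ) (b : Bool) =>
        q.2 ∈ Ψ.eval (strOracle q.1.1.2) q.1.2 ∧ q.1.1.1[2 * q.1.2]? = some b ∧
          q.2 ≠ cond b 1 0) ?_
      have f1 : Primrec fun q : (((List Bool × List Bool) × ℕ) × ℕ) × Bool => q.1.1.1 :=
        Primrec.fst.comp (Primrec.fst.comp Primrec.fst)
      have fn : Primrec fun q : (((List Bool × List Bool) × ℕ) × ℕ) × Bool => q.1.1.2 :=
        Primrec.snd.comp (Primrec.fst.comp Primrec.fst)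
      have fx : Primrec fun q : (((List Bool × List Bool) × ℕ) × ℕ) × Bool => q.1.2 :=
        Primrec.snd.comp Primrec.fst
      refine ((sig_eval Ψ).comp ((Primrec.snd.comp f1).pair (fn.pair fx))).and
        (Sig.of_prim (PrimrecPred.and ?_ ?_))
      · exact Primrec.eq.comp (Primrec.list_getElem?.comp (Primrec.fst.comp f1)
          (Primrec.nat_mul.comp (Primrec.const 2) fn)) (Primrec.option_some.comp Primrec.snd)
      · exact (Primrec.eq.comp fx (Primrec.cond Primrec.snd (Primrec.const 1)
          (Primrec.const 0))).not
  · intro i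
    obtain ⟨K, p, hon, hl, hp⟩ := exists_on S (i + 1)
    obtain ⟨⟨P, hP, hpP⟩, hA⟩ := id hon
    obtain ⟨m, hm⟩ : ∃ m, ∀ r ∈ P, ∀ m', m ≤ m' → (r = p ∨ ∃ n x b, x ∈ Ψ.eval (strOracle r) n ∧
        (res (join B C) m')[2 * n]? = some b ∧ x ≠ cond b 1 0) := by
      apply list_bound
      intro r hr
      by_cases hrp : r = p
      · exact ⟨0, fun _ _ => Or.inl hrp⟩
      · obtain ⟨n, v0, v1, h0, h1, hne⟩ := PV_split S.sound hP r hr p hpP hrp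
        have h2 := eval_str_chi Ψ hA h1
        rw [hΨ] at h2
        simp only [chi, Part.mem_some_iff] at h2
        refine ⟨2 * n + 1, fun m' hm' => Or.inr ⟨n, v0, B n, h0, ?_, h2 ▸ hne⟩⟩
        rw [res_getElem?, if_pos (by omega), jeven]
    obtain ⟨m₁, hm₁⟩ := nat_bound (fun s => 2 * Nat.pair s (K.reverse.getD s 0) + 1) K.length
    refine ⟨max m m₁, K, P, p, hP, hpP, ?_, ?_, fun r hr => hm r hr _ (le_max_left _ _)⟩
    · simp only
      conv_lhs => rw [← (extendsStr_iff A p).1 hA]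
      rw [res_getElem?, if_pos (by omega)]
    · intro s hs
      simp only at hs ⊢
      have hs' : s < K.length := by simpa using hs
      rw [res_getElem?, if_pos (lt_of_lt_of_le (hm₁ s hs') (le_max_right _ _)), jodd, hC]
      have : tokSeq spl A (Nat.pair s (K.reverse.getD s 0)) = true := by
        classical
        unfold tokSeq
        rw [decide_eq_true_iff]
        refine ⟨K, p, hon, ?_⟩
        rw [Nat.unpair_pair]
        simp [hs']
      rw [this]
  · rintro i m v ⟨K, P, p, hP, hp, hv, hver, helim⟩
    simp only at hv hver helim
    have hres := extendsStr_res (join B C) m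
    have hKon : ∃ p', On spl A K p' := by
      obtain ⟨K', p', hon', hl', -⟩ := exists_on S K.length
      refine ⟨p', ?_⟩
      have : K = K' := by
        apply List.reverse_injective
        apply List.ext_getElem?
        intro s
        by_cases hs : s < K.length
        · have h1 := hres.getElem? (hver s (by simpa using hs))
          rw [jodd, hC] at h1
          classical
          unfold tokSeq at h1
          rw [decide_eq_true_iff] at h1
          obtain ⟨K'', p'', hon'', hk⟩ := h1
          rw [Nat.unpair_pair] at hk
          rw [hon'.agree S hon'' (by omega) hk]
          simp [hs]
        · rw [List.getElem?_eq_none (by simp; omega), List.getElem?_eq_none (by simp; omega)]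
      rw [this]
      exact hon'
    obtain ⟨p', ⟨P', hP', hp'⟩, hA'⟩ := hKon
    have : P = P' := Option.some.inj (hP.symm.trans hP')
    subst this
    rcases helim p' hp' with h | ⟨n, x, b, hx, hb, hne⟩
    · subst h
      exact (hA'.getElem? hv).symm
    · exfalso
      have h1 := hres.getElem? hb
      rw [jeven] at h1
      have h2 := eval_str_chi Ψ hA' hx
      rw [hΨ] at h2
      simp only [chi, Part.mem_some_iff] at h2
      rw [h1] at h2
      exact hne h2

end Main

/-- every 1-generic Turing degree satisfies the join property:
for every non-zero degree `b` strictly below it, there is `c` strictly below it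
with `b ∨ c = a`. -/
theorem oneGeneric_join_property (A : ℕ → Bool) (hA : OneGeneric A) :
    ∀ B : ℕ → Bool, ¬ ComputableSeq B → TRed B A → ¬ TRed A B →
      ∃ C : ℕ → Bool, TRed C A ∧ ¬ TRed A C ∧ TEquiv (join B C) A := by
  intro B hB hBA _
  obtain ⟨Ψ, hΨ⟩ := id hBA
  obtain ⟨spl, S⟩ := exists_setup hA hΨ hB
  exact ⟨tokSeq spl A, tokSeq_le S, not_le_tokSeq S, tred_join hBA (tokSeq_le S), le_join S hΨ⟩

end TypicalDegree
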